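/- There is no party-approval rule for 6 voters, 4 parties, and committee size 3 that simultaneously satisfies anonymity, weak representation, Pareto optimality, and strategyproofness. -/

import Mathlib

/-- An approval profile is valid if every voter's ballot is nonempty. -/
def ValidProfile {P : Type*} (n : ℕ) (A : Fin n → Finset P) : Prop :=
  ∀ i, (A i).Nonempty

/-- The number of seats a committee `W` assigns to the parties in `X`. -/
def seats {P : Type*} [DecidableEq P] (W : Multiset P) (X : Finset P) : ℕ :=
  ∑ x ∈ X, W.count x

/-- A party-approval rule for `n` voters and committee size `k`:
it assigns to every (valid) approval profile a committee of size `k`. -/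
def IsPAPPRule {P : Type*} (n k : ℕ) (f : (Fin n → Finset P) → Multiset P) : Prop :=
  ∀ A, ValidProfile n A → Multiset.card (f A) = k

/-- Anonymity: permuting the voters does not change the outcome. -/
def Anonymous {P : Type*} (n : ℕ) (f : (Fin n → Finset P) → Multiset P) : Prop :=
  ∀ A, ValidProfile n A → ∀ π : Equiv.Perm (Fin n), f (fun i => A (π i)) = f A

/-- Weak representation: a party uniquely approved by at least `n / k` voters
gets at least one seat. -/
def WeakRep {P : Type*} [DecidableEq P] (n k : ℕ)
    (f : (Fin n → Finset P) → Multiset P) : Prop :=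
  ∀ A, ValidProfile n A → ∀ (x : P) (G : Finset (Fin n)),
    n ≤ k * G.card → (∀ i ∈ G, A i = {x}) → 1 ≤ (f A).count x

/-- Weak proportional representation: a party uniquely approved by at least
`ℓ * n / k` voters gets at least `ℓ` seats. -/
def WeakPropRep {P : Type*} [DecidableEq P] (n k : ℕ)
    (f : (Fin n → Finset P) → Multiset P) : Prop :=
  ∀ A, ValidProfile n A → ∀ (x : P) (G : Finset (Fin n)) (ℓ : ℕ),
    1 ≤ ℓ → ℓ * n ≤ k * G.card → (∀ i ∈ G, A i = {x}) → ℓ ≤ (f A).count x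

/-- Strategyproofness: no voter can increase the number of seats assigned to
her approved parties by misreporting her ballot. -/
def Strategyproof {P : Type*} [DecidableEq P] (n : ℕ)
    (f : (Fin n → Finset P) → Multiset P) : Prop :=
  ∀ A A' : Fin n → Finset P, ValidProfile n A → ValidProfile n A' →
    ∀ i : Fin n, (∀ j, j ≠ i → A j = A' j) →
      seats (f A') (A i) ≤ seats (f A) (A i)

/-- Pareto optimality: a Pareto-dominated party gets no seat. -/
def ParetoOptimal {P : Type*} [DecidableEq P] (n : ℕ)
    (f : (Fin n → Finset P) → Multiset P) : Prop :=
  ∀ A, ValidProfile n A → ∀ x y : P,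
    (∀ i, y ∈ A i → x ∈ A i) → (∃ i, x ∈ A i ∧ y ∉ A i) → (f A).count y = 0

namespace PartyApproval

/-! ### Numerical encodings of ballots, profiles and committees -/

/-- The binary code of a ballot. -/
def ballotCode (S : Finset (Fin 4)) : ℕ := ∑ x ∈ S, 2 ^ (x : ℕ)

/-- The ballot with a given binary code. -/
def ballotOfCode (b : ℕ) : Finset (Fin 4) := Finset.univ.filter fun x => b.testBit x

/-- The code of a profile: the base-8 digit at place `b` counts the voters with ballot code `b`. -/
def profileCode (A : Fin 6 → Finset (Fin 4)) : ℕ := ∑ i, 8 ^ ballotCode (A i)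

/-- The profile code of a list of ballot codes. -/
def listCode (l : List ℕ) : ℕ := (l.map (8 ^ ·)).sum

/-- The list of the committees of size three. -/
def committees : List (Multiset (Fin 4)) :=
  [{3, 3, 3}, {2, 3, 3}, {2, 2, 3}, {2, 2, 2}, {1, 3, 3}, {1, 2, 3}, {1, 2, 2}, {1, 1, 3},
   {1, 1, 2}, {1, 1, 1}, {0, 3, 3}, {0, 2, 3}, {0, 2, 2}, {0, 1, 3}, {0, 1, 2}, {0, 1, 1},
   {0, 0, 3}, {0, 0, 2}, {0, 0, 1}, {0, 0, 0}]

/-- The `i`-th committee of size three. -/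
def committee (i : ℕ) : Multiset (Fin 4) := committees.getD i 0

/-- The set of (indices of) committees that give at least `t` seats to the ballot with code `Z`,
as a bit mask. -/
def seatsMask (Z t : ℕ) : ℕ :=
  (20815864389328798163850463453048241507503004589930869502567897225712792097640546761858546732994000520147663502216212206422005606876244250373247304429960078997949778950327060940768590820958036255139882844690034750276149043044352663176983695859835169520776781183353817742995835165668726643465586066945181187694820138753112418195044178978693408283418149403612676599763812898044277634891775 >>> (20 * (4 * Z + t))) % 2 ^ 20

/-- An enumeration of the permutations of the four parties by the numbers below 24. -/
def partyPerm (s : ℕ) : Equiv.Perm (Fin 4) :=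
  Equiv.swap 3 (Fin.ofNat 4 (s / 6)) * Equiv.swap 2 (Fin.ofNat 4 (s / 2 % 3)) *
    Equiv.swap 1 (Fin.ofNat 4 (s % 2))

/-- For each permutation of the parties, the induced permutations of the ballot codes (four bits
per entry) and of the committee indices (five bits per entry). -/
def permTables : List (ℕ × ℕ) :=
  [(18282773019571545120, 366719417997519007880703912467),
    (18147662969134670400, 126362071021890044611514083859),
    (18119064671689558080, 121564788814633907700732575315),
    (17848844570815808640, 1404853677599350087583317587),
    (18263707487941470240, 365520087992045846763610944051),
    (17858377336630846080, 5002805879382325881271857715),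
    (17848863335241598080, 1629720752602633376897812969),
    (18119083436115347520, 121789655889637190990047070697),
    (18152448116467978560, 133782804796395185372352483561),
    (18355113192123290640, 774353722099972028581344710889),
    (17863162483964154240, 12423539653887466642110257417),
    (18336047660493215760, 773154392094498867464251742473),
    (18263763781218838560, 365782434058308838712245077379),
    (17858433629908214400, 5340105348765013915688617347),
    (17863200012815733120, 12535972048266871387212521667),
    (18336085189344794640, 773191871085758576123571380419),
    (18297128461571469600, 375376998583393525975545283651),
    (18364683486789906960, 775590568911341405915347682371),
    (18282904370552071200, 367019241910191778180443521344),
    (18147794320115196480, 126736848337682510997036319040),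
    (18152560703022715200, 133932715037184368468560223360),
    (18355225778678027280, 774428678937641515591769824384),
    (18297203519274627360, 375414476429803304326650759200),
    (18364758544493064720, 775628046757751184266453157920)]

/-- The code of the image of a ballot under a permutation of the parties. -/
def permBallot (s b : ℕ) : ℕ := ((permTables.getD s (0, 0)).1 >>> (4 * b)) % 16

/-- Auxiliary loop of `permMask`, processing the lowest `n` bits of `m`. -/
def permMaskAux (t m : ℕ) : ℕ → ℕ
  | 0 => 0
  | n + 1 => bif m.testBit n then permMaskAux t m n ||| 2 ^ ((t >>> (5 * n)) % 32)
      else permMaskAux t m n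

/-- The image of a set of committees under a permutation of the parties. -/
def permMask (s m : ℕ) : ℕ := permMaskAux (permTables.getD s (0, 0)).2 m 20

/-! ### A checker for derivations of constraints on the outcomes of a rule -/

/-- The strongest mask `seatsMask Z t` that contains the mask `m`. -/
def boundMask (Z m : ℕ) : ℕ :=
  bif m &&& seatsMask Z 3 == m then seatsMask Z 3
  else bif m &&& seatsMask Z 2 == m then seatsMask Z 2
  else bif m &&& seatsMask Z 1 == m then seatsMask Z 1
  else 2 ^ 20 - 1

/-- Whether the party `x` Pareto dominates the party `y` in a list of ballot codes. -/
def dominates (l : List ℕ) (x y : ℕ) : Bool :=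
  l.all (fun b => !b.testBit y || b.testBit x) && l.any (fun b => b.testBit x && !b.testBit y)

/-- The restriction that Pareto optimality and weak representation impose on party `y`. -/
def partyMask (l : List ℕ) (y : ℕ) : ℕ :=
  (bif (List.range 4).any (fun x => dominates l x y) then seatsMask (15 - 2 ^ y) 3
    else 2 ^ 20 - 1) &&&
  (bif Nat.ble 2 (l.count (2 ^ y)) then seatsMask (2 ^ y) 1 else 2 ^ 20 - 1)

/-- The committees allowed by Pareto optimality and weak representation. -/
def baseMask (l : List ℕ) : ℕ :=
  partyMask l 0 &&& partyMask l 1 &&& partyMask l 2 &&& partyMask l 3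

/-- The mask recorded for the profile code `q` in a context. -/
def lookupMask (q : ℕ) : List (ℕ × ℕ) → ℕ
  | [] => 2 ^ 20 - 1
  | e :: Γ => bif e.1 == q then e.2 else lookupMask q Γ

/-- The value `k n`, arranged so that the kernel evaluates `n` first. -/
def evalThen {α : Type} (n : ℕ) (k : ℕ → α) : α :=
  Nat.casesOn n (k 0) fun m => k m.succ

/-- Derivations of constraints. A context lists profile codes along with masks of committees that
the rule may choose there; entries of the context, and earlier results, are referred to by their
position, the most recent being 0. -/
inductive SeatDerivation
  /-- End of the derivation. -/
  | done
  /-- Use the `j`-th earlier result, with the parties permuted by the permutation `s`. -/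
  | reuse (j s : ℕ) (rest : SeatDerivation)
  /-- Apply strategyproofness to the `i`-th profile and the one in which a voter changes her ballot
  from `X` to `Y`. -/
  | move (i X Y : ℕ) (rest : SeatDerivation)
  /-- Show by the derivation `sub` that the `c`-th committee is not chosen for the `i`-th
  profile. -/
  | refute (i c : ℕ) (sub rest : SeatDerivation)

/-- The context that results from a derivation, or `none` if some step is not valid. -/
def SeatDerivation.run (D : List (List ℕ × ℕ)) :
    SeatDerivation → List (ℕ × ℕ) → Option (List (ℕ × ℕ))
  | .done, Γ => some Γ
  | .reuse j s rest, Γ =>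
    match D.drop j with
    | [] => none
    | (l, m) :: _ =>
      bif Nat.blt s 24 then
        evalThen (listCode (l.map (permBallot s))) fun q =>
          evalThen (lookupMask q Γ &&& permMask s m) fun m' => rest.run D ((q, m') :: Γ)
      else none
  | .move i X Y rest, Γ =>
    match Γ.drop i with
    | [] => none
    | (p, m) :: _ =>
      bif Nat.ble 1 X && (Nat.blt X 16 && (Nat.ble 1 Y && (Nat.blt Y 16 &&
          Nat.ble 1 (p / 8 ^ X % 8)))) then
        evalThen (p - 8 ^ X + 8 ^ Y) fun q =>
          evalThen (lookupMask q Γ &&& (boundMask Y m &&& boundMask (15 - X) m)) fun m' =>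
            rest.run D ((q, m') :: Γ)
      else none
  | .refute i c sub rest, Γ =>
    match Γ.drop i with
    | [] => none
    | (p, m) :: _ =>
      match sub.run D ((p, m &&& 2 ^ c) :: Γ) with
      | some ((_, 0) :: _) =>
        evalThen (m ^^^ (m &&& 2 ^ c)) fun m' => rest.run D ((p, m') :: Γ)
      | _ => none

/-- The steps of a derivation in linear notation; a subderivation extends from `assume` to the
matching `qed`. -/
inductive Step
  | reuse (j s : ℕ)
  | move (i X Y : ℕ)
  | assume (i c : ℕ)
  | qed

/-- Prepend a step to a stack of derivations. -/
def Step.push : Step → List SeatDerivation → List SeatDerivation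
  | .reuse j s, d :: st => .reuse j s d :: st
  | .move i X Y, d :: st => .move i X Y d :: st
  | .assume i c, sub :: d :: st => .refute i c sub d :: st
  | .qed, st => .done :: st
  | _, _ => []

/-- The derivation written as a list of steps. -/
def parseSteps (steps : List Step) : SeatDerivation := (steps.foldr Step.push [.done]).headD .done

/-- Whether the list consists of the codes of six nonempty ballots. -/
def validList (l : List ℕ) : Bool := l.length == 6 && l.all fun b => Nat.ble 1 b && Nat.blt b 16

/-- Whether the given derivations, each starting from the profile with the given ballots and using
the results of the previous ones, lead to a contradiction. -/
def refutesRule : List (List ℕ × List Step) → List (List ℕ × ℕ) → Bool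
  | [], _ => false
  | (l, steps) :: rest, D =>
    bif validList l then
      match (parseSteps steps).run D [(listCode l, baseMask l)] with
      | some Γ =>
        match Γ with
        | (_, 0) :: _ => true
        | _ => evalThen (lookupMask (listCode l) Γ) fun m => refutesRule rest ((l, m) :: D)
      | none => false
    else false

/-! ### Correctness of the encodings -/

theorem ballotOfCode_ballotCode : ∀ S, ballotOfCode (ballotCode S) = S := by decide +kernel

theorem ballotCode_ballotOfCode : ∀ b < 16, ballotCode (ballotOfCode b) = b := by decide +kernel

theorem ballotCode_lt : ∀ S, ballotCode S < 16 := by decide +kernel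

theorem ballotOfCode_nonempty : ∀ b < 16, 1 ≤ b → (ballotOfCode b).Nonempty := by decide +kernel

theorem ballotOfCode_two_pow : ∀ y : Fin 4, ballotOfCode (2 ^ (y : ℕ)) = {y} := by decide +kernel

theorem exists_committee_of_card {W : Multiset (Fin 4)} (hW : W.card = 3) :
    ∃ i < 20, W = committee i := by
  have h : ∀ s : Sym (Fin 4) 3, ∃ i < 20, s.1 = committee i := by decide +kernel
  exact h ⟨W, hW⟩

theorem committee_injOn : ∀ i < 20, ∀ j < 20, committee i = committee j → i = j := by
  decide +kernel

theorem testBit_seatsMask : ∀ Z < 16, ∀ t < 4, ∀ i < 20,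
    (seatsMask Z t).testBit i = true ↔ t ≤ seats (committee i) (ballotOfCode Z) := by
  decide +kernel

theorem seats_compl : ∀ Z < 16, ∀ i < 20,
    seats (committee i) (ballotOfCode (15 - Z)) + seats (committee i) (ballotOfCode Z) = 3 := by
  decide +kernel

theorem ballotCode_map : ∀ s < 24, ∀ S,
    ballotCode (S.map (partyPerm s).toEmbedding) = permBallot s (ballotCode S) := by
  decide +kernel

theorem committee_map : ∀ s < 24, ∀ i < 20,
    ((permTables.getD s (0, 0)).2 >>> (5 * i)) % 32 < 20 ∧
    (committee i).map (partyPerm s) =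
      committee (((permTables.getD s (0, 0)).2 >>> (5 * i)) % 32) := by
  decide +kernel

theorem sum_mul_pow_div_mod {u : ℕ → ℕ} (hu : ∀ b, u b < 8) (N X : ℕ) :
    (∑ b ∈ Finset.range N, u b * 8 ^ b) / 8 ^ X % 8 = if X < N then u X else 0 := by
  induction N generalizing u X with
  | zero => simp
  | succ N ih =>
    have hs : ∑ b ∈ Finset.range (N + 1), u b * 8 ^ b
        = 8 * (∑ b ∈ Finset.range N, u (b + 1) * 8 ^ b) + u 0 := by
      rw [Finset.sum_range_succ', Finset.mul_sum, pow_zero, mul_one]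
      congr 1
      exact Finset.sum_congr rfl fun b _ => by ring
    have h0 := hu 0
    cases X with
    | zero => rw [hs]; simp; omega
    | succ X =>
      have hd : (8 * (∑ b ∈ Finset.range N, u (b + 1) * 8 ^ b) + u 0) / 8
          = ∑ b ∈ Finset.range N, u (b + 1) * 8 ^ b := by omega
      rw [hs, pow_succ', ← Nat.div_div_eq_div_mul, hd, ih fun b => hu (b + 1)]
      simp

/-- The digits of the profile code count the voters with a given ballot. -/
theorem profileCode_div_mod (A : Fin 6 → Finset (Fin 4)) (X : ℕ) :
    profileCode A / 8 ^ X % 8 = (Finset.univ.filter fun i => ballotCode (A i) = X).card := by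
  have hs : profileCode A = ∑ b ∈ Finset.range 16,
      (Finset.univ.filter fun i => ballotCode (A i) = b).card * 8 ^ b := by
    rw [profileCode, ← Finset.sum_fiberwise_of_maps_to (t := Finset.range 16)
      (g := fun i => ballotCode (A i)) fun i _ => Finset.mem_range.2 (ballotCode_lt _)]
    refine Finset.sum_congr rfl fun b _ => ?_
    rw [Finset.sum_congr rfl (g := fun _ => 8 ^ b) fun i hi => by
      rw [(Finset.mem_filter.1 hi).2], Finset.sum_const, smul_eq_mul]
  rw [hs, sum_mul_pow_div_mod (u := fun b =>
    (Finset.univ.filter fun i => ballotCode (A i) = b).card)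
    fun b => (Finset.card_le_univ _).trans_lt (by simp)]
  split_ifs with hX
  · rfl
  · symm
    rw [Finset.card_eq_zero, Finset.filter_eq_empty_iff]
    intro i _ h
    exact hX (h ▸ ballotCode_lt (A i))

/-- Profiles with the same code differ by a permutation of the voters. -/
theorem exists_perm_of_profileCode_eq {A B : Fin 6 → Finset (Fin 4)}
    (h : profileCode A = profileCode B) : ∃ π : Equiv.Perm (Fin 6), A = fun i => B (π i) := by
  have hcard (S) : Fintype.card {i // A i = S} = Fintype.card {i // B i = S} := by
    have hS (C : Fin 6 → Finset (Fin 4)) (i) : C i = S ↔ ballotCode (C i) = ballotCode S :=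
      ⟨fun e => e ▸ rfl, fun e => by
        rw [← ballotOfCode_ballotCode (C i), e, ballotOfCode_ballotCode]⟩
    simp only [Fintype.card_subtype, hS, ← profileCode_div_mod, h]
  have e (S) : {i // A i = S} ≃ {i // B i = S} := Fintype.equivOfCardEq (hcard S)
  refine ⟨(Equiv.sigmaFiberEquiv A).symm.trans
    ((Equiv.sigmaCongrRight e).trans (Equiv.sigmaFiberEquiv B)), ?_⟩
  funext i
  exact ((e (A i)) ⟨i, rfl⟩).2.symm

theorem listCode_ofFn (A : Fin 6 → Finset (Fin 4)) :
    listCode (List.ofFn fun i => ballotCode (A i)) = profileCode A := by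
  rw [listCode, List.map_ofFn, List.sum_ofFn]
  rfl

theorem profileCode_update (A : Fin 6 → Finset (Fin 4)) (i : Fin 6) {Y : ℕ} (hY : Y < 16) :
    profileCode (Function.update A i (ballotOfCode Y))
      = profileCode A - 8 ^ ballotCode (A i) + 8 ^ Y := by
  have h (C : Fin 6 → Finset (Fin 4)) : profileCode C = 8 ^ ballotCode (C i) +
      ∑ j ∈ Finset.univ.erase i, 8 ^ ballotCode (C j) :=
    (Finset.add_sum_erase _ (fun j => 8 ^ ballotCode (C j)) (Finset.mem_univ i)).symm
  rw [h A, h (Function.update A i _), Function.update_self, ballotCode_ballotOfCode Y hY,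
    Nat.add_sub_cancel_left, add_comm]
  congr 1
  refine Finset.sum_congr rfl fun j hj => ?_
  rw [Function.update_of_ne (Finset.ne_of_mem_erase hj)]

/-! ### Sets of committees -/

/-- The committee `W` is among those described by the bit mask `m`. -/
def InMask (W : Multiset (Fin 4)) (m : ℕ) : Prop := ∃ i < 20, m.testBit i = true ∧ W = committee i

theorem not_inMask_zero (W : Multiset (Fin 4)) : ¬ InMask W 0 := by
  rintro ⟨i, -, hi, -⟩
  simp at hi

theorem inMask_full {W : Multiset (Fin 4)} (hW : W.card = 3) : InMask W (2 ^ 20 - 1) := by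
  obtain ⟨i, hi, rfl⟩ := exists_committee_of_card hW
  exact ⟨i, hi, by rw [Nat.testBit_two_pow_sub_one]; simpa using hi, rfl⟩

theorem InMask.and {W : Multiset (Fin 4)} {m m' : ℕ} (h : InMask W m) (h' : InMask W m') :
    InMask W (m &&& m') := by
  obtain ⟨i, hi, hm, rfl⟩ := h
  obtain ⟨j, hj, hm', he⟩ := h'
  obtain rfl := committee_injOn i hi j hj he
  exact ⟨i, hi, by simp [hm, hm'], rfl⟩

theorem inMask_seatsMask {W : Multiset (Fin 4)} (hW : W.card = 3) {Z t : ℕ} (hZ : Z < 16)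
    (ht : t < 4) : InMask W (seatsMask Z t) ↔ t ≤ seats W (ballotOfCode Z) := by
  constructor
  · rintro ⟨i, hi, hm, rfl⟩
    exact (testBit_seatsMask Z hZ t ht i hi).1 hm
  · intro h
    obtain ⟨i, hi, rfl⟩ := exists_committee_of_card hW
    exact ⟨i, hi, (testBit_seatsMask Z hZ t ht i hi).2 h, rfl⟩

theorem InMask.of_and_beq {W : Multiset (Fin 4)} {m m' : ℕ} (h : InMask W m)
    (hm : (m &&& m' == m) = true) : InMask W m' := by
  obtain ⟨i, hi, hb, rfl⟩ := h
  refine ⟨i, hi, ?_, rfl⟩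
  rw [← beq_iff_eq.1 hm, Nat.testBit_and] at hb
  exact (Bool.and_eq_true_iff.1 hb).2

theorem InMask.boundMask {V W : Multiset (Fin 4)} {Z m : ℕ} (h : InMask W m) (hW : W.card = 3)
    (hV : V.card = 3) (hZ : Z < 16)
    (hle : seats W (ballotOfCode Z) ≤ seats V (ballotOfCode Z)) : InMask V (boundMask Z m) := by
  have key {t} (ht : t < 4) (hm : (m &&& seatsMask Z t == m) = true) : InMask V (seatsMask Z t) :=
    (inMask_seatsMask hV hZ ht).2
      (((inMask_seatsMask hW hZ ht).1 (h.of_and_beq hm)).trans hle)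
  rw [PartyApproval.boundMask]
  cases h3 : m &&& seatsMask Z 3 == m
  · cases h2 : m &&& seatsMask Z 2 == m
    · cases h1 : m &&& seatsMask Z 1 == m
      · exact inMask_full hV
      · exact key (by norm_num) h1
    · exact key (by norm_num) h2
  · exact key (by norm_num) h3

theorem seats_compl_of_card {W : Multiset (Fin 4)} (hW : W.card = 3) {Z : ℕ} (hZ : Z < 16) :
    seats W (ballotOfCode (15 - Z)) + seats W (ballotOfCode Z) = 3 := by
  obtain ⟨i, hi, rfl⟩ := exists_committee_of_card hW
  exact seats_compl Z hZ i hi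

theorem testBit_permMaskAux {t m i n : ℕ} (hi : i < n) (hm : m.testBit i = true) :
    (permMaskAux t m n).testBit ((t >>> (5 * i)) % 32) = true := by
  induction n with
  | zero => omega
  | succ n ih =>
    rw [permMaskAux]
    obtain rfl | hlt := Nat.eq_or_lt_of_le (Nat.le_of_lt_succ hi)
    · simp [hm]
    · cases m.testBit n <;> simp [ih hlt]

theorem InMask.permMask {W : Multiset (Fin 4)} {m s : ℕ} (h : InMask W m) (hs : s < 24) :
    InMask (W.map (partyPerm s)) (permMask s m) := by
  obtain ⟨i, hi, hm, rfl⟩ := h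
  obtain ⟨hlt, he⟩ := committee_map s hs i hi
  exact ⟨_, hlt, testBit_permMaskAux hi hm, he⟩

/-! ### Rules with the desired properties -/

/-- The conjunction of the properties shown to be incompatible. -/
def Desirable (f : (Fin 6 → Finset (Fin 4)) → Multiset (Fin 4)) : Prop :=
  IsPAPPRule 6 3 f ∧ Anonymous 6 f ∧ WeakRep 6 3 f ∧ ParetoOptimal 6 f ∧ Strategyproof 6 f

/-- The rule `f` chooses a committee in the mask `e.2` for the profiles with code `e.1`. -/
def Holds (f : (Fin 6 → Finset (Fin 4)) → Multiset (Fin 4)) (e : ℕ × ℕ) : Prop :=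
  ∃ A, ValidProfile 6 A ∧ profileCode A = e.1 ∧ InMask (f A) e.2

section Desirable

variable {f : (Fin 6 → Finset (Fin 4)) → Multiset (Fin 4)}

theorem Desirable.eq_of_profileCode_eq (hf : Desirable f) {A B : Fin 6 → Finset (Fin 4)}
    (hB : ValidProfile 6 B) (h : profileCode A = profileCode B) : f A = f B := by
  obtain ⟨π, rfl⟩ := exists_perm_of_profileCode_eq h
  exact hf.2.1 B hB π

theorem Desirable.inMask_lookupMask (hf : Desirable f) {A : Fin 6 → Finset (Fin 4)}
    (hA : ValidProfile 6 A) {Γ : List (ℕ × ℕ)} (hΓ : ∀ e ∈ Γ, Holds f e) :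
    InMask (f A) (lookupMask (profileCode A) Γ) := by
  induction Γ with
  | nil => exact inMask_full (hf.1 A hA)
  | cons e Γ ih =>
    rw [lookupMask]
    cases he : e.1 == profileCode A
    · exact ih fun e' he' => hΓ e' (List.mem_cons_of_mem _ he')
    · obtain ⟨B, -, hB, hm⟩ := hΓ e List.mem_cons_self
      rw [beq_iff_eq] at he
      rwa [hf.eq_of_profileCode_eq hA (hB.trans he)] at hm

/-- Renaming the parties preserves all properties. -/
theorem Desirable.conj (hf : Desirable f) (σ : Equiv.Perm (Fin 4)) :
    Desirable fun A => (f fun i => (A i).map σ.toEmbedding).map σ.symm := by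
  have hv {A : Fin 6 → Finset (Fin 4)} (hA : ValidProfile 6 A) :
      ValidProfile 6 fun i => (A i).map σ.toEmbedding := fun i => (hA i).map
  have hc (W : Multiset (Fin 4)) (x) : (W.map σ.symm).count x = W.count (σ x) := by
    conv_lhs => rw [← σ.symm_apply_apply x]
    exact Multiset.count_map_eq_count' _ _ σ.symm.injective _
  have hs (W : Multiset (Fin 4)) (S) :
      seats (W.map σ.symm) S = seats W (S.map σ.toEmbedding) := by
    simp [seats, hc]
  have hm (S : Finset (Fin 4)) (x) : σ x ∈ S.map σ.toEmbedding ↔ x ∈ S := by simp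
  refine ⟨fun A hA => ?_, fun A hA π => ?_, fun A hA x G hG h => ?_, fun A hA x y h h' => ?_,
    fun A A' hA hA' i h => ?_⟩
  · rw [Multiset.card_map, hf.1 _ (hv hA)]
  · exact congrArg _ (hf.2.1 _ (hv hA) π)
  · rw [hc]
    exact hf.2.2.1 _ (hv hA) _ G hG fun i hi => by simp [h i hi]
  · rw [hc]
    exact hf.2.2.2.1 _ (hv hA) (σ x) (σ y) (fun i => by simpa only [hm] using h i)
      (by simpa only [hm] using h')
  · rw [hs, hs]
    exact hf.2.2.2.2 _ _ (hv hA) (hv hA') i fun j hj => by rw [h j hj]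

theorem Desirable.inMask_boundMask (hf : Desirable f) {A : Fin 6 → Finset (Fin 4)}
    (hA : ValidProfile 6 A) {m Y : ℕ} (hm : InMask (f A) m) (hY : 1 ≤ Y) (hY' : Y < 16)
    (i : Fin 6) :
    ValidProfile 6 (Function.update A i (ballotOfCode Y)) ∧
    InMask (f (Function.update A i (ballotOfCode Y)))
      (boundMask Y m &&& boundMask (15 - ballotCode (A i)) m) := by
  have hA' : ValidProfile 6 (Function.update A i (ballotOfCode Y)) := by
    intro j
    obtain rfl | hj := eq_or_ne j i
    · rw [Function.update_self]
      exact ballotOfCode_nonempty Y hY' hY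
    · rw [Function.update_of_ne hj]
      exact hA j
  have heq : ∀ j, j ≠ i → A j = Function.update A i (ballotOfCode Y) j :=
    fun j hj => (Function.update_of_ne hj _ _).symm
  have hX := ballotCode_lt (A i)
  refine ⟨hA', (hm.boundMask (hf.1 _ hA) (hf.1 _ hA') hY' ?_).and
    (hm.boundMask (hf.1 _ hA) (hf.1 _ hA') (by omega) ?_)⟩
  · have h := hf.2.2.2.2 _ _ hA' hA i fun j hj => (heq j hj).symm
    rwa [Function.update_self] at h
  · have h := hf.2.2.2.2 _ _ hA hA' i heq
    have h1 := seats_compl_of_card (hf.1 _ hA) hX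
    have h2 := seats_compl_of_card (hf.1 _ hA') hX
    rw [ballotOfCode_ballotCode] at h1 h2
    omega

theorem testBit_ballotCode : ∀ S, ∀ x : Fin 4, (ballotCode S).testBit x = true ↔ x ∈ S := by
  decide +kernel

theorem count_ofFn {α : Type*} [DecidableEq α] {n : ℕ} (g : Fin n → α) (a : α) :
    (List.ofFn g).count a = (Finset.univ.filter fun i => g i = a).card := by
  rw [← Multiset.coe_count, ← Fin.univ_val_map, Multiset.count_map]
  simp only [eq_comm (a := a)]
  rfl

theorem Desirable.inMask_partyMask (hf : Desirable f) {A : Fin 6 → Finset (Fin 4)}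
    (hA : ValidProfile 6 A) (y : Fin 4) :
    InMask (f A) (partyMask (List.ofFn fun i => ballotCode (A i)) y) := by
  have hcard := hf.1 A hA
  have hseats : seats (f A) (ballotOfCode (2 ^ (y : ℕ))) = (f A).count y := by
    rw [ballotOfCode_two_pow, seats, Finset.sum_singleton]
  have hlt : 2 ^ (y : ℕ) < 16 :=
    Nat.pow_lt_pow_right (by norm_num) y.2
  refine InMask.and ?_ ?_
  · cases h : (List.range 4).any fun x => dominates (List.ofFn fun i => ballotCode (A i)) x y
    · exact inMask_full hcard
    · refine (inMask_seatsMask hcard ((Nat.sub_le 15 _).trans_lt (by norm_num)) (by norm_num)).2 ?_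
      have h1 := seats_compl_of_card hcard hlt
      rw [hseats] at h1
      obtain ⟨x, hx, hd⟩ := List.any_eq_true.1 h
      obtain ⟨x, rfl⟩ : ∃ x' : Fin 4, (x' : ℕ) = x := ⟨⟨x, List.mem_range.1 hx⟩, rfl⟩
      have h0 : (f A).count y = 0 := by
        simp only [dominates, Bool.and_eq_true, List.all_eq_true, List.any_eq_true,
          List.mem_ofFn, exists_exists_eq_and, forall_exists_index, forall_apply_eq_imp_iff,
          Bool.or_eq_true,
          Bool.not_eq_true', testBit_ballotCode, ← Bool.not_eq_true] at hd
        exact hf.2.2.2.1 A hA x y (fun i hi => (hd.1 i).resolve_left (not_not_intro hi)) hd.2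
      omega
  · cases h : Nat.ble 2 ((List.ofFn fun i => ballotCode (A i)).count (2 ^ (y : ℕ)))
    · exact inMask_full hcard
    · refine (inMask_seatsMask hcard hlt (by norm_num)).2 ?_
      rw [hseats]
      refine hf.2.2.1 A hA y (Finset.univ.filter fun i => ballotCode (A i) = 2 ^ (y : ℕ)) ?_
        fun i hi => ?_
      · have h2 := Nat.le_of_ble_eq_true h
        rw [count_ofFn] at h2
        omega
      · rw [← ballotOfCode_ballotCode (A i), (Finset.mem_filter.1 hi).2, ballotOfCode_two_pow]

theorem Desirable.inMask_baseMask (hf : Desirable f) {A : Fin 6 → Finset (Fin 4)}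
    (hA : ValidProfile 6 A) : InMask (f A) (baseMask (List.ofFn fun i => ballotCode (A i))) :=
  (((hf.inMask_partyMask hA 0).and (hf.inMask_partyMask hA 1)).and
    (hf.inMask_partyMask hA 2)).and (hf.inMask_partyMask hA 3)

end Desirable

/-! ### Soundness of the checker -/

theorem evalThen_eq {α : Type} (n : ℕ) (k : ℕ → α) : evalThen n k = k n := by
  cases n <;> rfl

theorem mem_of_drop_eq_cons {α : Type} {l t : List α} {a : α} {i : ℕ} (h : l.drop i = a :: t) :
    a ∈ l :=
  List.mem_of_mem_drop (h ▸ List.mem_cons_self)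

/-- Every desirable rule chooses a committee in `e.2` for some profile with ballot codes `e.1`. -/
def Established (e : List ℕ × ℕ) : Prop :=
  ∀ f, Desirable f → ∃ A, ValidProfile 6 A ∧ (List.ofFn fun i => ballotCode (A i)) = e.1 ∧
    InMask (f A) e.2

theorem Established.holds_perm {l : List ℕ} {m s : ℕ} (h : Established (l, m)) (hs : s < 24)
    {f : (Fin 6 → Finset (Fin 4)) → Multiset (Fin 4)} (hf : Desirable f) :
    Holds f (listCode (l.map (permBallot s)), permMask s m) := by
  obtain ⟨A, hA, rfl, hm⟩ := h _ (hf.conj (partyPerm s))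
  refine ⟨fun i => (A i).map (partyPerm s).toEmbedding, fun i => (hA i).map, ?_, ?_⟩
  · rw [← listCode_ofFn, List.map_ofFn]
    congr 2
    funext i
    exact ballotCode_map s hs _
  · have h := hm.permMask hs
    rw [Multiset.map_map] at h
    simpa using h

theorem SeatDerivation.holds_of_run_eq_some {D : List (List ℕ × ℕ)}
    (hD : ∀ e ∈ D, Established e) {f : (Fin 6 → Finset (Fin 4)) → Multiset (Fin 4)}
    (hf : Desirable f) (d : SeatDerivation) {Γ Γ' : List (ℕ × ℕ)} (hΓ : ∀ e ∈ Γ, Holds f e)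
    (hd : d.run D Γ = some Γ') : ∀ e ∈ Γ', Holds f e := by
  induction d generalizing Γ Γ' with
  | done =>
    obtain rfl : Γ = Γ' := by simpa [run] using hd
    exact hΓ
  | reuse j s rest ih =>
    rw [run] at hd
    split at hd
    · simp at hd
    · next l m t he =>
      cases hs : Nat.blt s 24
      · simp [hs] at hd
      · simp only [hs, cond_true, evalThen_eq] at hd
        refine ih (List.forall_mem_cons.2 ⟨?_, hΓ⟩) hd
        obtain ⟨A, hA, hq, hm⟩ :=
          (hD _ (mem_of_drop_eq_cons he)).holds_perm (Nat.le_of_ble_eq_true hs) hf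
        refine ⟨A, hA, hq, InMask.and ?_ hm⟩
        simpa only [hq] using hf.inMask_lookupMask hA hΓ
  | move i X Y rest ih =>
    rw [run] at hd
    split at hd
    · simp at hd
    · next p m t he =>
      obtain ⟨A, hA, rfl, hm⟩ := hΓ _ (mem_of_drop_eq_cons he)
      cases hc : Nat.ble 1 X && (Nat.blt X 16 && (Nat.ble 1 Y && (Nat.blt Y 16 &&
          Nat.ble 1 (profileCode A / 8 ^ X % 8))))
      · simp only [hc, cond_false, reduceCtorEq] at hd
      · simp only [hc, cond_true, evalThen_eq] at hd
        refine ih (List.forall_mem_cons.2 ⟨?_, hΓ⟩) hd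
        simp only [Bool.and_eq_true] at hc
        obtain ⟨-, -, hY, hY', hX⟩ := hc
        replace hX := Nat.le_of_ble_eq_true hX
        rw [profileCode_div_mod, Nat.succ_le_iff, Finset.card_pos] at hX
        obtain ⟨v, hv⟩ := hX
        obtain rfl := (Finset.mem_filter.1 hv).2
        replace hY' : Y < 16 := Nat.le_of_ble_eq_true hY'
        obtain ⟨hv', hm'⟩ := hf.inMask_boundMask hA hm (Nat.le_of_ble_eq_true hY) hY' v
        refine ⟨_, hv', profileCode_update A v hY', InMask.and ?_ hm'⟩
        rw [← profileCode_update A v hY']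
        exact hf.inMask_lookupMask hv' hΓ
  | refute i c sub rest ihs ih =>
    rw [run] at hd
    split at hd
    · simp at hd
    · next p m t he =>
      obtain ⟨A, hA, hp, j, hj, hm, hW⟩ := hΓ _ (mem_of_drop_eq_cons he)
      have hold {m'} (hm' : m'.testBit j = true) : ∀ e ∈ (p, m') :: Γ, Holds f e :=
        List.forall_mem_cons.2 ⟨⟨A, hA, hp, j, hj, hm', hW⟩, hΓ⟩
      split at hd
      · next q Δ hsub =>
        rw [evalThen_eq] at hd
        obtain rfl | hjc := eq_or_ne c j
        · obtain ⟨B, -, -, hB⟩ := ihs (hold (by simpa using hm)) hsub _ List.mem_cons_self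
          exact (not_inMask_zero _ hB).elim
        · refine ih (hold ?_) hd
          simpa [hjc] using hm
      · simp at hd

theorem not_desirable_of_refutesRule (c : List (List ℕ × List Step)) (D : List (List ℕ × ℕ))
    (hD : ∀ e ∈ D, Established e) (hc : refutesRule c D = true)
    (f : (Fin 6 → Finset (Fin 4)) → Multiset (Fin 4)) : ¬ Desirable f := by
  induction c generalizing D with
  | nil => simp [refutesRule] at hc
  | cons e c ih =>
    obtain ⟨l, steps⟩ := e
    rw [refutesRule] at hc
    cases hl : validList l
    · simp [hl] at hc
    simp only [hl, cond_true] at hc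
    split at hc
    swap
    · simp at hc
    next Γ hrun =>
    simp only [validList, Bool.and_eq_true, beq_iff_eq, List.all_eq_true] at hl
    obtain ⟨hlen, hl⟩ := hl
    obtain ⟨a, rfl⟩ : ∃ a : Fin 6 → ℕ, List.ofFn a = l := by
      exact ⟨fun i => l[i], List.ext_getElem (by simp [hlen]) fun _ _ _ => List.getElem_ofFn _⟩
    have ha (i) : 1 ≤ a i ∧ a i < 16 := by
      have h := hl (a i) (List.mem_ofFn.2 ⟨i, rfl⟩)
      exact ⟨Nat.le_of_ble_eq_true h.1, Nat.le_of_ble_eq_true h.2⟩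
    have hcode : (List.ofFn fun i => ballotCode (ballotOfCode (a i))) = List.ofFn a := by
      congr 1
      funext i
      exact ballotCode_ballotOfCode _ (ha i).2
    have hA : ValidProfile 6 fun i => ballotOfCode (a i) :=
      fun i => ballotOfCode_nonempty _ (ha i).2 (ha i).1
    have hp : profileCode (fun i => ballotOfCode (a i)) = listCode (List.ofFn a) := by
      rw [← listCode_ofFn, hcode]
    have key {g} (hg : Desirable g) : ∀ e ∈ Γ, Holds g e := by
      refine SeatDerivation.holds_of_run_eq_some hD hg _ ?_ hrun
      refine List.forall_mem_singleton.2 ⟨_, hA, hp, ?_⟩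
      rw [← hcode]
      exact hg.inMask_baseMask hA
    split at hc
    · intro hf
      obtain ⟨B, -, -, hB⟩ := key hf _ List.mem_cons_self
      exact not_inMask_zero _ hB
    · rw [evalThen_eq] at hc
      refine ih _ (List.forall_mem_cons.2 ⟨fun g hg => ⟨_, hA, hcode, ?_⟩, hD⟩) hc
      rw [← hp]
      exact hg.inMask_lookupMask hA (key hg)

/-- Derivations of a contradiction from the existence of a rule with the desired properties. -/
def certificate : List (List ℕ × List Step) := [
  ([1, 1, 1, 1, 2, 2], []),
  ([1, 1, 1, 1, 2, 6], [.reuse 0 17, .move 0 2 6]),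
  ([1, 1, 1, 2, 3, 6], [.reuse 0 23, .move 0 1 3]),
  ([1, 1, 1, 1, 6, 10], [.reuse 1 23, .move 0 2 10]),
  ([1, 1, 1, 2, 6, 10], [.reuse 2 23, .move 0 1 10]),
  ([1, 1, 1, 2, 6, 9], [.reuse 3 23, .move 0 1 9]),
  ([1, 1, 1, 2, 5, 6], [.reuse 4 23, .move 0 1 5]),
  ([1, 1, 1, 2, 6, 8], [.reuse 5 23, .move 0 1 8]),
  ([1, 1, 1, 2, 6, 12], [.reuse 6 23, .move 0 1 12]),
  ([1, 1, 1, 1, 6, 6], [.reuse 7 23, .move 0 2 6]),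
  ([1, 1, 1, 2, 4, 6], [.reuse 8 23, .move 0 1 4]),
  ([1, 1, 1, 2, 6, 6], [.reuse 9 23, .move 0 1 6]),
  ([1, 1, 1, 6, 6, 6], [.reuse 2 21, .move 0 1 6]),
  ([1, 1, 1, 6, 6, 10], [.reuse 3 21, .move 0 1 10]),
  ([1, 1, 1, 6, 6, 9], [.reuse 4 21, .move 0 1 9]),
  ([1, 1, 1, 5, 6, 6], [.reuse 5 21, .move 0 1 5]),
  ([1, 1, 1, 6, 6, 8], [.reuse 6 21, .move 0 1 8]),
  ([1, 1, 1, 3, 6, 10], [.reuse 13 17, .move 0 1 3]),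
  ([1, 1, 1, 5, 6, 10], [.reuse 14 17, .move 0 1 5]),
  ([1, 1, 1, 2, 2, 4], []),
  ([1, 1, 1, 2, 4, 10], [.reuse 12 17, .reuse 0 23, .move 0 2 10]),
  ([1, 1, 1, 2, 2, 12], []),
  ([1, 1, 1, 2, 3, 12], [.reuse 0 17, .move 0 2 3]),
  ([1, 1, 2, 3, 6, 8], [.reuse 20 23, .move 0 1 8]),
  ([1, 1, 2, 3, 5, 6], [.reuse 21 23, .move 0 1 5]),
  ([1, 1, 2, 3, 6, 12], [.reuse 22 23, .move 0 1 12]),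
  ([1, 1, 2, 3, 6, 9], [.reuse 23 23, .move 0 1 9]),
  ([1, 1, 2, 3, 4, 6], [.reuse 24 23, .move 0 1 4]),
  ([1, 1, 2, 3, 3, 12], [.reuse 5 17, .move 0 1 3]),
  ([1, 1, 2, 4, 6, 9], [.reuse 18 21, .move 0 1 9]),
  ([1, 1, 2, 4, 6, 10], [.reuse 19 21, .move 0 1 10]),
  ([1, 1, 2, 4, 9, 10], [.reuse 10 23, .move 0 1 9]),
  ([1, 1, 2, 4, 5, 10], [.reuse 11 23, .move 0 1 5]),
  ([1, 1, 2, 3, 4, 10], [.reuse 9 17, .reuse 12 23, .move 0 1 3]),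
  ([1, 1, 2, 4, 10, 10], [.reuse 13 23, .move 0 1 10]),
  ([1, 1, 2, 4, 10, 12], [.reuse 14 23, .move 0 1 12]),
  ([1, 1, 2, 5, 6, 10], [.reuse 29 23, .move 0 1 10]),
  ([1, 1, 2, 5, 6, 9], [.reuse 30 23, .move 0 1 9]),
  ([1, 1, 2, 5, 6, 6], [.reuse 31 23, .move 0 1 6]),
  ([1, 1, 2, 5, 5, 6], [.reuse 32 23, .move 0 1 5]),
  ([1, 1, 2, 5, 6, 12], [.reuse 33 23, .move 0 1 12]),
  ([1, 1, 2, 5, 10, 10], [.reuse 35 17, .move 0 1 10]),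
  ([1, 1, 2, 5, 5, 10], [.reuse 36 17, .move 0 1 5]),
  ([1, 1, 2, 5, 10, 12], [.reuse 37 17, .move 0 1 12]),
  ([1, 1, 2, 6, 6, 12], [.reuse 32 23, .move 0 1 12]),
  ([1, 1, 2, 6, 6, 6], [.reuse 33 23, .move 0 1 6]),
  ([1, 1, 2, 6, 10, 12], [.reuse 41 17, .move 0 1 12]),
  ([1, 1, 2, 6, 12, 12], [.reuse 38 23, .move 0 1 12]),
  ([1, 1, 2, 3, 12, 12], [.reuse 31 9, .move 0 1 3]),
  ([1, 1, 2, 9, 12, 12], [.reuse 32 9, .move 0 1 9]),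
  ([1, 1, 3, 6, 6, 9], [.reuse 34 21, .move 0 1 9]),
  ([1, 1, 3, 6, 9, 10], [.reuse 33 17, .move 0 1 9]),
  ([1, 1, 3, 6, 10, 12], [.reuse 34 17, .move 0 1 12]),
  ([1, 1, 3, 6, 12, 12], [.reuse 34 21, .move 0 1 12]),
  ([1, 1, 3, 3, 6, 12], [.reuse 35 21, .move 0 1 3]),
  ([1, 1, 3, 6, 9, 12], [.reuse 36 21, .move 0 1 9]),
  ([1, 1, 3, 3, 12, 12], [.reuse 41 9, .move 0 1 3]),
  ([1, 1, 6, 6, 6, 12], [.reuse 44 21, .move 0 1 12]),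
  ([1, 1, 2, 2, 3, 4], []),
  ([1, 1, 2, 3, 4, 10], [.reuse 25 23, .reuse 0 22, .move 0 2 10]),
  ([1, 1, 2, 2, 4, 4], []),
  ([1, 2, 2, 4, 4, 9], [.reuse 0 18, .move 0 1 9]),
  ([1, 1, 2, 2, 4, 5], [.reuse 1 18, .move 0 4 5]),
  ([1, 1, 2, 4, 5, 9], [.reuse 0 23, .move 0 2 9]),
  ([1, 1, 2, 3, 4, 5], [.reuse 1 23, .move 0 2 3]),
  ([1, 1, 2, 4, 5, 6], [.reuse 37 21, .reuse 2 23, .move 0 2 6]),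
  ([1, 2, 2, 4, 5, 9], [.reuse 35 22, .reuse 3 23, .move 0 1 9]),
  ([1, 1, 2, 2, 5, 5], [.reuse 4 23, .move 0 4 5]),
  ([1, 1, 2, 4, 5, 10], [.reuse 35 23, .reuse 5 23, .move 0 2 10]),
  ([1, 1, 2, 2, 4, 9], []),
  ([1, 1, 2, 4, 9, 10], [.reuse 38 23, .reuse 0 23, .move 0 2 10]),
  ([1, 1, 2, 4, 10, 12], [.reuse 35 21, .reuse 9 19, .move 0 2 10]),
  ([1, 1, 2, 4, 6, 12], [.reuse 5 20, .reuse 10 19, .move 0 2 6]),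
  ([1, 1, 2, 2, 5, 12], [.reuse 11 19, .move 0 4 5]),
  ([1, 1, 2, 2, 12, 12], [.reuse 12 19, .move 0 4 12]),
  ([1, 1, 2, 5, 5, 10], [.reuse 32 23, .reuse 7 23, .move 0 2 10]),
  ([1, 2, 2, 5, 5, 5], [.reuse 30 22, .reuse 8 23, .move 0 1 5]),
  ([1, 1, 2, 5, 5, 6], [.reuse 37 23, .reuse 9 23, .move 0 2 6]),
  ([1, 1, 1, 2, 2, 5], [.reuse 10 23, .move 0 5 1]),
  ([1, 1, 2, 2, 5, 9], [.reuse 11 23, .move 0 5 9]),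
  ([1, 1, 2, 2, 5, 6], []),
  ([1, 2, 2, 5, 6, 9], [.reuse 44 22, .reuse 0 22, .move 0 1 9]),
  ([1, 1, 2, 3, 5, 6], [.reuse 57 23, .reuse 1 22, .move 0 2 3]),
  ([1, 1, 2, 5, 9, 10], [.reuse 45 17, .reuse 3 17, .move 0 2 10]),
  ([1, 1, 2, 5, 9, 12], [.reuse 4 17, .move 0 2 12]),
  ([1, 2, 2, 5, 9, 12], [.reuse 38 16, .reuse 11 23, .move 0 1 9]),
  ([1, 1, 2, 5, 10, 12], [.reuse 42 23, .reuse 12 23, .move 0 2 10]),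
  ([1, 2, 2, 3, 5, 12], [.reuse 61 22, .reuse 13 23, .move 0 1 3]),
  ([1, 1, 2, 5, 12, 12], [.reuse 38 17, .reuse 14 23, .move 0 2 12]),
  ([1, 1, 2, 3, 5, 12], [.reuse 15 23, .move 0 2 3]),
  ([1, 1, 2, 5, 6, 12], [.reuse 49 23, .reuse 16 23, .move 0 2 6]),
  ([1, 2, 2, 5, 5, 12], [.reuse 46 22, .reuse 17 23, .move 0 1 5]),
  ([1, 2, 2, 9, 12, 12], [.reuse 44 16, .reuse 17 16, .move 0 1 9]),
  ([1, 1, 2, 3, 12, 12], [.reuse 44 17, .reuse 18 16, .move 0 2 3]),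
  ([1, 2, 3, 4, 5, 9], [.reuse 29 21, .move 0 1 9]),
  ([1, 2, 3, 4, 5, 6], [.reuse 29 21, .move 0 1 5]),
  ([1, 2, 3, 4, 6, 9], [.reuse 30 21, .move 0 1 9]),
  ([1, 2, 3, 4, 9, 9], [.reuse 33 21, .move 0 1 9]),
  ([1, 1, 3, 4, 10, 10], [.reuse 9 21, .reuse 38 23, .move 0 2 10]),
  ([1, 2, 3, 4, 9, 10], [.reuse 39 23, .move 0 1 9]),
  ([1, 2, 3, 4, 10, 12], [.reuse 40 23, .move 0 1 12]),
  ([1, 2, 3, 4, 5, 12], [.reuse 4 20, .reuse 32 21, .move 0 1 5]),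
  ([1, 1, 2, 3, 12, 12], [.reuse 8 17, .reuse 33 21, .move 0 4 12]),
  ([1, 2, 3, 4, 9, 12], [.reuse 2 22, .reuse 34 21, .move 0 1 9]),
  ([1, 2, 3, 4, 12, 12], [.reuse 35 21, .move 0 1 12]),
  ([1, 2, 3, 3, 4, 12], [.reuse 36 21, .move 0 1 3]),
  ([1, 2, 3, 5, 6, 9], [.reuse 23 23, .move 0 1 9]),
  ([1, 2, 3, 5, 6, 12], [.reuse 24 23, .move 0 1 12]),
  ([1, 2, 3, 5, 10, 12], [.reuse 81 17, .move 0 1 12]),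
  ([1, 2, 3, 5, 9, 12], [.reuse 19 23, .move 0 1 9]),
  ([1, 2, 3, 5, 5, 12], [.reuse 20 23, .move 0 1 5]),
  ([1, 1, 3, 5, 6, 12], [.reuse 59 9, .reuse 21 23, .move 0 2 6]),
  ([1, 1, 3, 5, 10, 12], [.reuse 56 9, .reuse 22 23, .move 0 2 10]),
  ([1, 2, 3, 6, 12, 12], [.reuse 25 22, .move 0 1 12]),
  ([1, 1, 3, 3, 6, 12], [.reuse 59 23, .reuse 26 22, .move 0 2 3]),
  ([1, 2, 3, 6, 9, 12], [.reuse 6 17, .reuse 27 22, .move 0 1 9]),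
  ([1, 1, 3, 10, 12, 12], [.reuse 62 17, .reuse 13 17, .move 0 2 10]),
  ([1, 1, 2, 10, 12, 12], [.reuse 24 22, .reuse 14 17, .move 0 3 10]),
  ([1, 2, 3, 9, 12, 12], [.reuse 4 16, .reuse 15 17, .move 0 1 9]),
  ([1, 1, 3, 3, 12, 12], [.reuse 62 17, .reuse 16 17, .move 0 2 3]),
  ([1, 2, 3, 3, 12, 12], [.reuse 17 17, .move 0 1 3]),
  ([1, 1, 2, 4, 6, 6], []),
  ([1, 2, 4, 6, 6, 9], [.reuse 16 18, .reuse 0 21, .move 0 1 9]),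
  ([1, 2, 4, 6, 9, 9], [.reuse 18 18, .reuse 93 21, .move 0 1 9]),
  ([1, 2, 4, 6, 10, 10], [.reuse 26 18, .reuse 51 21, .move 0 1 10]),
  ([1, 2, 3, 4, 6, 10], [.reuse 30 18, .reuse 52 21, .move 0 1 3]),
  ([1, 2, 4, 6, 10, 12], [.reuse 26 18, .reuse 53 21, .move 0 1 12]),
  ([1, 2, 4, 6, 9, 10], [.reuse 23 18, .reuse 54 21, .move 0 1 9]),
  ([1, 2, 3, 4, 9, 10], [.reuse 1 19, .reuse 57 23, .move 0 1 3]),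
  ([1, 2, 4, 9, 10, 12], [.reuse 58 23, .move 0 1 12]),
  ([1, 2, 4, 5, 9, 10], [.reuse 2 22, .reuse 59 23, .move 0 1 5]),
  ([1, 2, 4, 9, 10, 12], [.reuse 1 18, .reuse 59 21, .move 0 1 9]),
  ([1, 2, 5, 5, 6, 10], [.reuse 54 23, .move 0 1 10]),
  ([1, 2, 5, 5, 6, 9], [.reuse 55 23, .move 0 1 9]),
  ([1, 2, 5, 5, 10, 12], [.reuse 58 23, .move 0 1 12]),
  ([1, 2, 5, 5, 9, 10], [.reuse 59 23, .move 0 1 9]),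
  ([1, 2, 5, 5, 10, 10], [.reuse 60 23, .move 0 1 10]),
  ([1, 1, 2, 5, 5, 12], []),
  ([1, 2, 3, 5, 5, 12], [.reuse 27 23, .reuse 0 23, .move 0 1 3]),
  ([1, 2, 5, 6, 6, 9], [.reuse 6 22, .reuse 100 23, .move 0 1 9]),
  ([1, 2, 5, 6, 9, 9], [.reuse 4 17, .reuse 56 17, .move 0 1 9]),
  ([1, 2, 5, 6, 9, 10], [.reuse 57 17, .move 0 1 10]),
  ([1, 1, 5, 6, 9, 10], [.reuse 29 9, .reuse 58 17, .move 0 2 10]),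
  ([1, 2, 5, 5, 6, 9], [.reuse 9 23, .reuse 59 17, .move 0 1 5]),
  ([1, 2, 5, 6, 9, 12], [.reuse 60 17, .move 0 1 12]),
  ([1, 2, 5, 6, 10, 12], [.reuse 0 22, .reuse 63 22, .move 0 1 12]),
  ([1, 2, 5, 6, 9, 10], [.reuse 4 16, .reuse 64 22, .move 0 1 9]),
  ([1, 1, 5, 6, 10, 10], [.reuse 30 9, .reuse 65 22, .move 0 2 10]),
  ([1, 2, 3, 5, 6, 10], [.reuse 41 22, .reuse 66 22, .move 0 1 3]),
  ([1, 2, 5, 6, 12, 12], [.reuse 58 23, .move 0 1 12]),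
  ([1, 2, 5, 6, 9, 12], [.reuse 4 22, .reuse 59 23, .move 0 1 9]),
  ([1, 1, 5, 6, 10, 12], [.reuse 98 9, .reuse 60 23, .move 0 2 10]),
  ([1, 2, 3, 5, 6, 12], [.reuse 44 22, .reuse 61 23, .move 0 1 3]),
  ([1, 2, 3, 5, 9, 12], [.reuse 43 17, .reuse 68 17, .move 0 1 3]),
  ([1, 2, 5, 10, 10, 12], [.reuse 19 16, .reuse 112 23, .move 0 1 12]),
  ([1, 2, 3, 5, 10, 12], [.reuse 39 17, .reuse 68 23, .move 0 1 3]),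
  ([1, 2, 5, 5, 10, 12], [.reuse 1 16, .reuse 69 23, .move 0 1 5]),
  ([1, 2, 5, 9, 10, 12], [.reuse 6 17, .reuse 70 23, .move 0 1 9]),
  ([1, 2, 3, 5, 12, 12], [.reuse 39 17, .reuse 59 21, .move 0 1 3]),
  ([1, 2, 5, 12, 12, 12], [.reuse 60 21, .move 0 1 12]),
  ([1, 1, 6, 6, 6, 10], [.reuse 102 21, .reuse 83 22, .move 0 2 10]),
  ([1, 2, 6, 6, 9, 12], [.reuse 4 22, .reuse 69 22, .move 0 1 9]),
  ([1, 2, 6, 9, 10, 12], [.reuse 4 22, .reuse 76 16, .move 0 1 9]),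
  ([1, 2, 5, 6, 12, 12], [.reuse 13 22, .reuse 45 17, .move 0 1 5]),
  ([1, 3, 3, 6, 9, 12], [.reuse 49 23, .move 0 1 9]),
  ([1, 3, 3, 6, 12, 12], [.reuse 50 23, .move 0 1 12]),
  ([1, 3, 3, 9, 12, 12], [.reuse 46 17, .move 0 1 9]),
  ([1, 3, 3, 3, 12, 12], [.reuse 47 17, .move 0 1 3]),
  ([1, 3, 5, 6, 10, 12], [.reuse 56 21, .move 0 1 12]),
  ([1, 3, 5, 6, 9, 10], [.reuse 57 21, .move 0 1 9]),
  ([1, 3, 3, 5, 10, 12], [.reuse 5 17, .reuse 27 11, .move 0 1 3]),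
  ([1, 1, 3, 6, 6, 10], []),
  ([1, 3, 6, 9, 10, 12], [.reuse 3 15, .reuse 20 15, .move 0 1 9]),
  ([1, 3, 6, 12, 12, 12], [.reuse 25 21, .move 0 1 12]),
  ([1, 3, 4, 4, 4, 6], [.reuse 167 20, .reuse 95 20, .move 0 1 3]),
  ([1, 6, 6, 6, 9, 10], [.reuse 1 15, .reuse 14 23, .move 0 1 9]),
  ([1, 6, 6, 6, 8, 10], [.reuse 16 14, .reuse 15 23, .move 0 1 8]),
  ([2, 2, 2, 5, 6, 9], [.reuse 158 22, .reuse 2 21, .move 0 1 9]),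
  ([1, 2, 3, 3, 12, 12], [.reuse 57 16, .reuse 55 19, .move 0 4 12]),
  ([2, 3, 3, 9, 12, 12], [.reuse 13 16, .reuse 0 16, .move 0 1 9]),
  ([1, 2, 3, 10, 12, 12], [.reuse 21 16, .reuse 1 16, .move 0 3 10]),
  ([1, 2, 3, 5, 9, 12], [.reuse 27 17, .reuse 55 20, .move 0 4 12]),
  ([1, 2, 3, 5, 10, 12], [.reuse 26 16, .reuse 80 21, .move 0 4 12]),
  ([1, 3, 5, 5, 10, 12], [.reuse 12 21, .reuse 44 23, .move 0 2 10]),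
  ([1, 5, 5, 6, 9, 10], [.reuse 0 11, .reuse 40 23, .move 0 2 10]),
  ([1, 5, 5, 6, 10, 10], [.reuse 5 8, .reuse 45 22, .move 0 2 10]),
  ([3, 3, 3, 5, 12, 12], [.reuse 18 17, .move 0 1 5]),
  ([1, 2, 5, 6, 9, 12], [
    .reuse 24 16, .assume 0 15, .reuse 56 17, .move 1 12 8, .reuse 100 17, .move 3 5 1,
    .reuse 118 17, .move 3 5 1, .move 2 12 8, .qed]),
  ([1, 3, 5, 6, 9, 12], [.reuse 18 9, .reuse 0 23, .move 0 2 3]),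
  ([1, 5, 6, 9, 10, 12], [.reuse 16 15, .reuse 1 23, .move 0 2 10]),
  ([1, 2, 3, 5, 9, 12], [
    .reuse 8 17, .assume 0 15, .reuse 104 17, .reuse 104 23, .move 2 3 2, .reuse 117 18,
    .move 1 12 4, .reuse 116 23, .move 3 9 1, .reuse 127 23, .move 3 9 1, .move 0 4 12, .qed]),
  ([1, 1, 2, 6, 10, 12], [
    .reuse 105 16, .assume 0 18, .reuse 117 22, .move 1 10 2, .reuse 118 21, .move 3 12 4,
    .reuse 128 22, .move 1 10 2, .move 4 12 4, .qed]),
  ([1, 1, 1, 2, 2, 6], []),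
  ([1, 1, 2, 2, 5, 10], []),
  ([1, 1, 2, 2, 3, 12], [
    .assume 0 13, .move 0 12 8, .reuse 124 17, .move 1 3 5, .reuse 174 16, .move 3 3 2, .reuse 1 16,
    .move 1 8 9, .move 0 9 5, .reuse 0 16, .move 6 8 10, .move 0 10 2, .qed]),
  ([1, 1, 2, 3, 3, 12], [.reuse 166 17, .reuse 0 16, .reuse 0 22, .move 0 2 3]),
  ([1, 1, 2, 3, 4, 10], [
    .reuse 136 23, .assume 0 14, .reuse 161 23, .move 1 3 10, .reuse 175 23, .move 3 3 1,
    .reuse 154 23, .move 3 4 5, .move 0 5 1, .reuse 191 17, .move 1 10 6, .move 5 4 6, .qed]),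
  ([1, 2, 3, 4, 9, 10], [
    .reuse 68 22, .assume 0 14, .reuse 0 22, .move 1 10 2, .reuse 0 23, .move 3 9 1, .move 2 9 1,
    .move 1 10 2, .qed]),
  ([1, 2, 5, 6, 9, 12], [
    .reuse 10 23, .assume 0 1, .move 0 2 8, .reuse 67 17, .move 2 12 8, .move 3 1 8, .reuse 15 10,
    .move 4 5 3, .move 3 6 12, .move 4 5 12, .reuse 10 13, .move 2 1 3, .move 2 2 3, .reuse 96 17,
    .move 1 6 2, .move 0 1 5, .move 10 6 3, .qed]),
  ([1, 3, 5, 6, 10, 12], [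
    .reuse 9 11, .assume 0 6, .move 0 12 4, .move 0 6 4, .reuse 111 20, .move 2 3 1, .reuse 21 18,
    .reuse 24 23, .reuse 190 20, .move 5 5 4, .reuse 130 19, .move 7 3 2, .reuse 125 20,
    .move 7 5 4, .move 0 1 5, .move 3 2 6, .move 0 6 4, .move 1 5 4, .move 1 1 3, .move 0 5 1,
    .move 2 10 3, .move 0 6 10, .qed]),
  ([1, 2, 3, 5, 10, 12], [.reuse 17 16, .reuse 0 21, .reuse 0 23, .move 0 6 2]),
  ([1, 3, 5, 8, 10, 12], [.reuse 54 10, .reuse 1 21, .reuse 1 23, .move 0 6 8]),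
  ([1, 3, 5, 6, 10, 12], [.reuse 2 21, .reuse 1 16, .move 0 2 6]),
  ([1, 3, 5, 6, 10, 12], [
    .reuse 0 21, .assume 0 12, .move 0 12 4, .move 0 6 4, .reuse 115 20, .move 2 3 1, .reuse 194 20,
    .move 3 5 4, .reuse 134 19, .move 5 3 2, .reuse 25 18, .reuse 129 20, .move 6 5 4, .move 3 2 6,
    .move 1 1 5, .move 0 6 4, .move 1 5 4, .move 1 1 3, .move 0 5 1, .reuse 28 23, .move 1 10 6,
    .move 0 3 10, .qed]),
  ([1, 2, 4, 9, 10, 12], [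
    .reuse 72 18, .assume 0 2, .move 0 1 4, .reuse 132 19, .reuse 132 20, .move 3 12 4, .move 4 2 4,
    .move 1 9 12, .move 2 10 12, .reuse 117 1, .move 7 10 3, .reuse 117 8, .move 4 2 3, .move 4 1 3,
    .reuse 174 19, .move 8 9 3, .move 2 9 1, .move 0 2 10, .qed]),
  ([1, 1, 3, 6, 10, 12], [
    .reuse 53 15, .assume 0 16, .move 0 3 9, .reuse 1 17, .move 2 1 9, .reuse 93 15, .move 4 12 9,
    .move 2 3 1, .move 0 12 8, .move 1 6 2, .move 3 10 8, .reuse 122 17, .move 5 6 2, .reuse 136 17,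
    .move 3 3 2, .move 2 3 2, .reuse 131 17, .move 1 10 12, .move 3 2 10, .reuse 139 17,
    .move 1 6 2, .move 0 8 12, .move 4 2 10, .qed]),
  ([1, 2, 3, 4, 9, 12], [
    .reuse 75 21, .assume 0 4, .move 0 1 10, .move 1 12 10, .move 2 9 10, .move 3 4 10, .reuse 5 23,
    .move 2 4 5, .reuse 7 18, .move 5 1 5, .reuse 2 16, .move 8 4 5, .move 6 1 5, .move 0 9 1,
    .move 1 12 4, .reuse 104 21, .move 1 9 1, .move 3 12 4, .qed]),
  ([1, 2, 3, 4, 9, 12], [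
    .reuse 0 23, .assume 0 7, .move 0 1 10, .move 1 12 10, .move 2 9 10, .move 3 4 10, .reuse 3 16,
    .move 4 4 5, .reuse 6 23, .move 4 4 5, .move 4 1 5, .move 0 9 1, .reuse 8 18, .move 2 12 4,
    .move 10 1 5, .reuse 105 21, .move 4 12 4, .move 0 1 9, .qed]),
  ([1, 2, 3, 5, 6, 12], [
    .reuse 55 22, .assume 0 6, .reuse 117 23, .move 1 3 1, .move 2 6 4, .reuse 178 19, .move 1 5 4,
    .reuse 135 22, .move 3 3 2, .move 0 2 6, .reuse 124 8, .reuse 135 23, .move 8 5 4, .move 0 1 5,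
    .move 0 5 4, .move 1 6 4, .move 1 2 3, .move 0 6 2, .reuse 124 1, .move 1 1 5, .move 0 3 1, .qed]),
  ([1, 2, 3, 5, 6, 8], [.reuse 11 16, .reuse 0 22, .reuse 0 23, .move 0 12 8]),
  ([1, 2, 3, 4, 5, 6], [.reuse 114 18, .reuse 1 22, .reuse 1 23, .move 0 12 4]),
  ([1, 2, 4, 5, 6, 10], [.reuse 109 20, .reuse 0 18, .reuse 0 20, .move 0 3 10]),
  ([1, 2, 2, 3, 4, 5], [.reuse 146 18, .reuse 1 20, .reuse 1 22, .move 0 6 2]),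
  ([1, 3, 4, 5, 6, 10], [.reuse 4 20, .reuse 2 18, .reuse 2 22, .move 0 2 10]),
  ([1, 2, 5, 6, 10, 12], [.reuse 15 22, .reuse 2 23, .move 0 4 12]),
  ([2, 2, 3, 4, 5, 9], [.reuse 124 18, .reuse 2 23, .move 0 1 9]),
  ([1, 2, 3, 5, 6, 12], [
    .reuse 2 18, .assume 0 8, .move 0 3 2, .move 1 6 2, .reuse 147 18, .move 1 5 4, .reuse 207 22,
    .move 3 3 2, .reuse 41 21, .reuse 142 22, .move 7 5 1, .move 5 4 6, .move 1 1 3, .move 0 3 2,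
    .move 1 6 2, .move 1 12 5, .move 0 6 12, .reuse 38 19, .move 1 1 3, .move 0 5 1, .qed]),
  ([1, 2, 3, 5, 12, 12], [.reuse 36 16, .reuse 0 23, .move 0 6 12]),
  ([1, 1, 2, 3, 6, 12], [.reuse 130 22, .reuse 1 22, .move 0 5 1]),
  ([1, 3, 5, 6, 10, 12], [.reuse 15 21, .reuse 2 22, .move 0 2 10]),
  ([1, 1, 2, 3, 6, 6], []),
  ([1, 1, 1, 2, 5, 6], [
    .reuse 46 18, .assume 0 12, .move 0 6 4, .reuse 8 20, .move 2 1 4, .move 2 2 4, .move 3 1 5,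
    .reuse 2 21, .move 3 2 10, .move 2 1 3, .reuse 98 18, .move 5 1 3, .move 3 1 5, .reuse 0 20,
    .move 2 1 3, .reuse 2 20, .move 1 3 10, .move 0 4 5, .reuse 106 20, .move 2 1 5, .move 0 3 1,
    .move 0 4 6, .move 4 10 2, .move 1 6 2, .move 1 3 10, .qed]),
  ([1, 1, 2, 3, 6, 10], []),
  ([1, 2, 3, 5, 6, 9], [
    .reuse 74 22, .assume 0 15, .move 0 6 2, .move 1 3 2, .reuse 51 22, .move 2 1 5, .reuse 7 23,
    .reuse 45 23, .reuse 154 22, .move 5 5 4, .move 4 5 4, .move 1 1 3, .reuse 214 18, .move 2 3 2,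
    .reuse 149 18, .move 4 5 4, .move 0 4 6, .move 0 6 2, .move 1 3 2, .reuse 1 18, .move 2 9 5,
    .move 2 4 5, .move 1 3 9, .move 0 4 6, .qed]),
  ([1, 3, 5, 6, 9, 10], [.reuse 35 15, .reuse 0 23, .move 0 2 10]),
  ([1, 2, 5, 5, 9, 10], [
    .reuse 84 17, .assume 0 10, .reuse 13 16, .move 1 5 8, .move 2 2 8, .reuse 1 15, .move 1 5 3,
    .move 3 2 3, .qed]),
  ([1, 1, 3, 5, 6, 10], [
    .reuse 114 21, .assume 0 15, .move 0 5 4, .move 1 6 10, .reuse 108 9, .move 2 3 10, .move 0 1 3,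
    .reuse 59 9, .move 4 1 5, .reuse 8 21, .move 1 5 4, .reuse 108 8, .move 1 5 4, .reuse 102 18,
    .move 3 3 2, .move 2 4 6, .move 0 3 2, .move 1 6 2, .reuse 0 0, .move 1 1 5, .move 0 3 1,
    .reuse 0 16, .move 1 4 6, .move 0 5 4, .qed]),
  ([1, 1, 2, 3, 5, 6], [.reuse 144 23, .reuse 0 23, .move 0 10 2]),
  ([1, 1, 2, 5, 6, 9], [
    .reuse 144 17, .assume 0 12, .move 0 2 4, .reuse 16 22, .move 2 1 4, .reuse 4 21, .move 1 2 3,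
    .move 0 3 1, .qed]),
  ([1, 1, 1, 3, 6, 12], [
    .reuse 51 20, .assume 0 15, .move 0 12 2, .reuse 10 23, .move 2 1 2, .reuse 1 23, .move 1 12 5,
    .move 0 5 1, .qed]),
  ([1, 2, 3, 5, 9, 12], [
    .reuse 39 17, .assume 0 5, .reuse 15 22, .move 1 3 6, .reuse 6 23, .move 3 12 6, .reuse 5 9,
    .move 5 2 6, .reuse 29 17, .move 7 5 6, .move 4 5 12, .move 3 3 2, .reuse 143 17, .move 1 5 1,
    .move 0 1 3, .qed]),
  ([1, 1, 3, 5, 10, 12], [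
    .reuse 88 11, .assume 0 11, .reuse 180 9, .move 1 10 12, .reuse 83 15, .move 3 5 12,
    .reuse 25 9, .move 5 3 6, .reuse 4 11, .move 7 3 9, .move 0 5 6, .reuse 4 21, .move 8 12 6,
    .reuse 83 21, .move 1 5 12, .move 2 3 10, .move 0 10 8, .move 11 12 8, .reuse 39 11,
    .move 8 9 8, .move 2 3 6, .reuse 159 15, .reuse 159 17, .move 2 10 2, .reuse 113 17,
    .move 10 3 2, .move 0 12 8, .move 10 5 2, .reuse 113 15, .move 12 5 6, .move 0 6 2, .qed]),
  ([1, 3, 3, 5, 10, 12], [.reuse 47 15, .reuse 0 23, .move 0 1 3]),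
  ([1, 1, 1, 3, 6, 12], [
    .reuse 3 23, .assume 0 14, .reuse 6 21, .move 1 1 5, .reuse 217 21, .move 3 12 6, .reuse 1 15,
    .reuse 1 17, .move 6 1 9, .move 3 6 10, .reuse 6 23, .move 1 1 5, .reuse 1 21, .reuse 1 23,
    .move 10 6 10, .reuse 27 17, .move 4 5 12, .move 5 6 12, .reuse 6 15, .move 10 6 10,
    .move 11 9 10, .move 0 6 5, .move 0 5 9, .qed]),
  ([1, 2, 5, 6, 9, 12], [
    .reuse 19 22, .assume 0 2, .move 0 12 4, .reuse 70 22, .move 2 9 12, .move 0 12 4, .move 0 12 4,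
    .move 0 1 9, .move 1 5 4, .move 6 6 4, .reuse 165 20, .move 8 5 4, .move 0 1 5, .move 1 2 3,
    .move 4 9 3, .move 2 6 4, .reuse 12 19, .move 1 9 3, .reuse 225 19, .move 1 5 9, .reuse 223 19,
    .move 3 5 1, .reuse 12 20, .move 14 2 3, .move 0 6 2, .move 0 1 9, .move 1 4 5, .reuse 220 20,
    .move 2 2 3, .reuse 161 19, .move 3 5 9, .move 0 2 6, .move 0 6 4, .move 4 3 1, .qed]),
  ([1, 3, 6, 12, 12, 12], [
    .reuse 59 9, .assume 0 8, .reuse 17 22, .move 1 12 2, .move 2 1 2, .move 3 3 2, .move 2 12 6,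
    .move 3 1 5, .move 2 12 4, .reuse 2 18, .move 3 1 9, .move 6 12 8, .move 7 12 5, .move 4 12 5,
    .move 1 3 2, .reuse 23 5, .move 4 12 4, .move 0 4 6, .move 0 8 9, .move 0 12 4, .move 5 12 4,
    .move 7 12 6, .reuse 112 21, .move 3 3 1, .reuse 14 18, .move 4 12 5, .reuse 22 19, .move 1 5 1,
    .move 4 9 5, .move 1 2 6, .qed]),
  ([1, 2, 5, 12, 12, 12], [
    .reuse 59 0, .assume 0 17, .move 0 5 1, .move 1 2 1, .move 2 12 4, .move 0 12 6, .move 2 12 6,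
    .move 4 12 8, .reuse 13 9, .move 2 12 4, .reuse 154 8, .reuse 12 8, .move 2 1 9, .move 3 1 3,
    .reuse 15 21, .move 5 12 6, .move 3 5 1, .move 11 1 3, .reuse 31 12, .move 13 4 8, .reuse 8 19,
    .move 3 12 4, .reuse 149 9, .move 6 12 10, .reuse 163 11, .move 8 9 8, .move 10 6 10,
    .move 0 5 9, .reuse 167 23, .move 2 6 2, .reuse 163 17, .move 23 12 10, .reuse 164 15,
    .reuse 164 17, .move 26 12 6, .reuse 118 15, .move 10 4 6, .move 17 5 1, .reuse 44 11,
    .move 7 2 6, .move 3 6 2, .move 11 1 3, .reuse 8 20, .move 29 12 4, .move 0 6 10, .move 4 2 10,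
    .move 0 12 4, .reuse 162 21, .move 3 5 1, .move 0 4 6, .reuse 154 18, .move 29 6 10,
    .reuse 163 20, .move 1 5 1, .move 0 4 5, .move 0 5 1, .move 0 2 6, .reuse 118 9, .move 1 3 10,
    .move 2 3 9, .move 1 10 8, .move 1 9 8, .qed]),
  ([1, 2, 5, 5, 10, 12], [
    .reuse 75 22, .assume 0 1, .move 0 5 12, .move 1 10 8, .reuse 0 16, .move 2 5 12, .move 0 12 8,
    .move 0 12 8, .reuse 8 14, .move 1 2 3, .move 2 12 9, .reuse 27 10, .move 8 5 9, .move 9 2 8,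
    .move 0 5 3, .move 2 12 8, .reuse 207 13, .move 7 10 2, .reuse 195 10, .move 4 5 3, .move 4 5 3,
    .move 1 3 2, .move 0 12 9, .reuse 8 13, .move 2 1 9, .move 0 3 1, .move 0 12 10, .reuse 168 13,
    .move 5 3 6, .move 0 6 10, .qed]),
  ([1, 3, 6, 12, 12, 12], [
    .reuse 2 23, .assume 0 14, .reuse 51 2, .move 1 1 3, .move 2 12 4, .move 1 12 4, .move 2 3 2,
    .reuse 187 19, .move 2 12 4, .reuse 14 20, .move 5 12 5, .move 4 3 2, .move 1 6 2, .move 2 3 2,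
    .reuse 169 21, .move 2 5 1, .reuse 74 22, .move 8 3 2, .move 2 4 6, .move 7 12 5, .move 8 12 9,
    .reuse 14 19, .move 4 4 5, .reuse 66 18, .move 4 12 5, .reuse 17 18, .move 1 12 4, .move 2 5 9,
    .move 3 5 1, .reuse 90 4, .move 9 12 9, .move 10 12 4, .reuse 151 22, .move 12 12 1,
    .move 5 2 10, .reuse 9 22, .move 7 5 9, .reuse 151 16, .reuse 164 22, .move 10 5 1, .move 9 9 1,
    .move 14 2 10, .move 2 2 3, .reuse 169 4, .move 12 12 8, .move 0 8 10, .reuse 37 19,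
    .reuse 14 1, .move 6 5 12, .reuse 26 23, .move 8 5 1, .move 2 12 9, .move 29 5 1, .move 30 3 1,
    .reuse 169 18, .move 2 6 2, .move 13 6 10, .move 11 4 5, .move 7 1 9, .move 2 1 5, .reuse 18 0,
    .reuse 18 4, .move 34 2 10, .move 7 4 5, .move 5 4 12, .move 11 4 12, .move 0 12 10,
    .move 2 9 1, .move 0 6 2, .move 5 2 10, .move 0 3 2, .move 0 5 6, .move 1 12 6, .move 0 5 12,
    .move 1 1 9, .move 1 10 9, .reuse 9 16, .move 1 12 10, .move 0 1 5, .qed]),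
  ([1, 3, 4, 6, 12, 12], [.reuse 13 8, .reuse 0 23, .move 0 12 4]),
  ([1, 2, 4, 6, 12, 12], [.reuse 115 21, .reuse 0 23, .move 0 3 2]),
  ([1, 3, 4, 4, 6, 12], [.reuse 12 20, .reuse 1 23, .move 0 12 4]),
  ([1, 3, 4, 4, 4, 6], [.reuse 20 20, .reuse 0 23, .move 0 12 4]),
  ([1, 2, 3, 5, 9, 12], [
    .reuse 12 17, .assume 0 13, .move 0 5 9, .move 1 5 3, .move 2 5 1, .reuse 19 17, .move 4 12 10,
    .reuse 15 17, .move 1 5 1, .move 2 9 8, .reuse 1 12, .move 4 3 1, .reuse 24 17, .move 4 9 12,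
    .reuse 174 16, .move 5 3 2, .move 4 5 9, .reuse 213 12, .move 4 2 3, .reuse 234 17, .move 6 3 1,
    .move 5 5 9, .reuse 27 14, .reuse 16 15, .move 19 2 10, .reuse 9 17, .move 1 9 1, .move 2 3 2,
    .move 0 12 9, .move 1 9 1, .reuse 170 17, .move 3 9 8, .move 5 1 3, .move 1 1 3, .reuse 47 17,
    .move 2 10 2, .reuse 231 17, .move 7 12 10, .reuse 229 15, .move 9 2 10, .reuse 238 17,
    .move 3 10 6, .reuse 105 17, .move 14 10 12, .move 2 10 2, .move 0 1 9, .move 2 1 3,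
    .move 0 9 12, .move 12 1 9, .reuse 119 13, .move 2 9 8, .reuse 229 11, .move 12 10 12,
    .move 0 10 8, .move 5 12 8, .reuse 201 22, .move 10 1 9, .move 3 1 3, .move 3 3 6, .move 2 9 8,
    .move 1 3 2, .reuse 106 10, .move 4 1 3, .move 0 3 2, .move 3 6 10, .move 0 9 12, .move 2 12 10,
    .move 1 2 3, .qed]),
  ([1, 1, 2, 3, 5, 12], [
    .reuse 154 23, .assume 0 14, .reuse 0 17, .reuse 0 23, .move 2 1 9, .move 3 1 5, .reuse 16 23,
    .move 5 12 6, .reuse 17 21, .move 7 2 6, .reuse 1 18, .move 3 3 1, .move 0 1 5, .reuse 26 23,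
    .move 9 9 12, .reuse 28 20, .move 6 3 2, .move 2 12 5, .move 1 12 5, .reuse 106 23,
    .move 1 6 12, .move 0 1 3, .qed]),
  ([1, 1, 3, 5, 10, 12], [
    .reuse 13 21, .assume 0 14, .reuse 18 23, .move 1 12 6, .reuse 0 21, .move 3 12 4, .reuse 0 23,
    .move 5 10 2, .reuse 11 21, .move 5 3 1, .move 4 10 2, .move 3 12 4, .move 0 3 1, .reuse 2 18,
    .move 1 4 6, .move 0 2 10, .qed]),
  ([1, 2, 5, 6, 9, 10], [
    .reuse 44 0, .assume 0 18, .move 0 5 1, .move 1 9 1, .reuse 177 17, .move 2 10 8, .reuse 216 21,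
    .reuse 204 17, .move 5 10 6, .reuse 177 23, .move 6 6 4, .reuse 204 23, .move 8 6 10,
    .move 7 8 12, .move 8 6 3, .move 9 1 3, .move 7 6 4, .move 8 6 12, .move 7 4 12, .move 8 10 3,
    .move 9 1 3, .move 8 10 12, .move 7 8 12, .move 3 4 12, .assume 7 17, .reuse 4 18, .move 1 4 5,
    .move 2 4 12, .move 0 6 5, .move 2 6 12, .move 0 9 3, .move 1 9 10, .move 1 5 9, .reuse 177 15,
    .move 1 9 8, .move 0 12 10, .move 4 5 3, .move 0 12 8, .reuse 173 15, .move 1 3 6, .move 2 10 6,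
    .move 1 1 3, .move 1 1 9, .reuse 216 12, .move 1 3 2, .reuse 173 14, .move 3 9 8, .move 0 8 10,
    .move 0 10 2, .move 1 3 2, .reuse 4 15, .move 1 8 9, .move 0 10 8, .reuse 4 14, .move 1 1 3,
    .move 6 1 9, .qed, .reuse 4 19, .move 1 2 3, .move 2 9 3, .move 1 6 2, .move 0 9 5,
    .reuse 177 21, .move 1 5 12, .move 0 12 6, .move 0 6 10, .reuse 173 21, .move 2 3 10,
    .move 2 1 5, .move 1 1 3, .reuse 122 18, .reuse 173 20, .move 3 5 4, .move 4 3 10, .move 1 4 6,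
    .move 0 6 10, .move 1 3 10, .reuse 6 21, .move 1 4 5, .reuse 6 20, .move 4 1 5, .move 2 6 4,
    .move 1 3 1, .qed]),
  ([1, 2, 5, 5, 10, 12], [
    .reuse 9 23, .assume 0 10, .reuse 39 13, .move 1 5 8, .move 2 2 8, .reuse 0 10, .reuse 0 15,
    .move 2 5 3, .move 4 2 3, .qed]),
  ([1, 2, 3, 4, 9, 12], [
    .reuse 40 23, .assume 0 10, .move 0 4 8, .reuse 40 3, .move 2 1 8, .move 2 12 8, .reuse 175 16,
    .move 4 3 2, .move 0 1 3, .reuse 1 4, .reuse 1 5, .move 6 4 6, .reuse 179 13, .move 7 3 6,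
    .move 0 1 3, .move 3 6 2, .move 4 12 8, .move 0 6 2, .move 2 12 8, .qed]),
  ([1, 2, 3, 5, 10, 12], [
    .reuse 48 16, .assume 0 15, .reuse 14 22, .move 1 3 6, .move 2 12 4, .reuse 0 22, .move 4 5 4,
    .move 5 10 2, .reuse 162 16, .move 7 3 2, .reuse 39 0, .reuse 180 18, .move 4 5 4,
    .reuse 240 22, .move 6 3 2, .reuse 54 22, .move 8 5 1, .move 9 5 9, .move 5 2 6, .move 6 4 6,
    .reuse 162 18, .move 8 1 9, .move 9 12 6, .reuse 240 16, .reuse 227 16, .move 8 3 2,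
    .move 4 2 10, .move 4 1 9, .move 2 1 3, .reuse 0 3, .move 1 12 4, .reuse 175 22, .assume 28 8,
    .move 0 10 2, .move 0 5 1, .move 0 1 3, .move 0 3 2, .move 1 6 2, .reuse 15 22, .move 1 1 5,
    .move 0 3 1, .reuse 6 21, .move 1 12 6, .move 6 12 5, .qed, .reuse 180 20, .reuse 180 19,
    .assume 2 6, .move 0 5 4, .move 1 12 4, .move 1 10 3, .move 0 12 4, .move 0 6 4, .move 1 3 9,
    .move 0 1 5, .move 5 6 4, .move 0 10 6, .move 0 1 9, .move 0 5 4, .move 1 6 4, .reuse 15 19,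
    .move 2 2 3, .reuse 240 19, .move 1 6 2, .move 0 9 1, .reuse 6 22, .move 1 1 5, .move 0 3 9,
    .qed, .move 0 6 2, .reuse 7 21, .move 1 12 6, .move 2 5 3, .move 3 12 9, .reuse 180 16,
    .move 5 12 8, .move 6 12 4, .reuse 3 12, .move 8 1 3, .reuse 3 0, .move 8 1 9, .move 8 12 8,
    .reuse 0 12, .move 7 2 6, .move 8 1 3, .reuse 7 20, .move 9 1 3, .move 8 5 1, .reuse 240 12,
    .reuse 238 12, .move 3 5 1, .move 3 10 6, .reuse 180 12, .move 5 10 8, .move 3 10 6,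
    .reuse 8 20, .move 5 2 10, .move 6 10 2, .move 7 2 6, .move 7 3 1, .move 6 8 9, .reuse 36 17,
    .move 8 1 9, .reuse 219 12, .reuse 186 22, .move 10 3 1, .reuse 180 22, .move 12 3 9,
    .move 13 3 10, .move 12 10 12, .move 12 1 9, .move 11 1 5, .move 12 12 5, .move 12 3 2,
    .move 13 12 8, .reuse 57 16, .move 15 3 5, .move 2 3 6, .move 3 3 2, .move 4 1 5, .reuse 176 12,
    .move 6 3 5, .move 16 1 5, .move 15 4 5, .reuse 8 21, .move 16 2 10, .move 15 2 6,
    .move 14 2 10, .reuse 177 0, .reuse 177 4, .reuse 131 4, .move 9 1 5, .move 10 8 10,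
    .move 10 2 10, .move 8 10 8, .move 8 3 10, .reuse 57 4, .move 5 5 4, .reuse 2 16, .reuse 2 23,
    .move 7 2 6, .move 8 10 6, .move 9 10 2, .reuse 0 21, .move 3 6 4, .move 4 5 4, .move 5 9 1,
    .reuse 176 18, .move 6 6 4, .reuse 237 16, .move 7 5 9, .reuse 180 23, .move 5 6 4,
    .reuse 131 0, .move 5 1 9, .move 6 2 6, .move 5 9 8, .move 6 9 12, .move 5 1 3, .move 4 9 8,
    .move 3 2 6, .reuse 6 15, .move 5 8 10, .move 6 1 5, .move 6 2 10, .reuse 15 12, .move 2 8 10,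
    .reuse 176 20, .move 9 5 4, .move 8 2 10, .reuse 7 15, .move 10 8 10, .move 9 9 8, .move 6 9 8,
    .move 5 1 9, .move 6 4 6, .move 7 1 5, .move 5 1 5, .move 6 9 8, .move 6 2 3, .move 6 2 3,
    .move 5 4 12, .move 6 3 8, .move 5 5 4, .move 6 9 8, .reuse 8 15, .move 7 2 6, .reuse 186 12,
    .move 8 10 8, .reuse 180 0, .move 5 6 4, .reuse 175 12, .move 11 10 8, .move 6 6 4,
    .reuse 175 0, .move 11 6 4, .reuse 176 14, .move 8 2 6, .move 7 8 12, .reuse 37 3, .move 7 8 9,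
    .move 5 2 3, .move 4 1 9, .move 2 3 4, .reuse 162 19, .move 3 3 5, .move 4 4 12, .move 5 9 12,
    .reuse 57 0, .move 5 8 12, .move 6 4 12, .move 4 3 5, .reuse 0 7, .assume 103 5, .reuse 31 16,
    .move 1 4 12, .reuse 150 12, .move 1 3 2, .reuse 125 13, .move 3 10 8, .reuse 131 23,
    .move 5 3 1, .move 4 12 9, .move 1 1 9, .reuse 131 22, .move 2 10 12, .move 0 2 10, .move 0 9 8,
    .move 1 10 8, .reuse 9 16, .move 1 1 3, .move 0 9 1, .reuse 9 17, .move 5 2 3, .move 2 2 10,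
    .qed, .reuse 2 4, .reuse 2 5, .assume 2 13, .move 0 1 9, .move 1 4 6, .move 0 12 8,
    .move 2 10 8, .reuse 176 15, .move 2 3 1, .move 2 4 6, .move 1 1 9, .move 1 12 8, .reuse 180 13,
    .move 1 3 1, .move 0 8 10, .qed, .move 0 3 6, .move 1 2 6, .reuse 2 1, .reuse 2 18, .move 4 1 5,
    .move 0 3 1, .move 1 5 4, .reuse 180 1, .move 1 10 8, .reuse 0 19, .move 1 3 10, .move 0 4 5,
    .assume 160 5, .move 0 5 4, .move 1 12 8, .move 1 12 8, .move 1 5 4, .qed, .move 0 12 9,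
    .move 1 10 9, .move 2 12 4, .reuse 0 15, .move 3 10 8, .move 2 1 9, .move 3 6 4, .move 1 6 4,
    .move 1 4 12, .move 2 1 3, .move 2 9 8, .move 1 3 2, .move 0 4 12, .reuse 176 4, .move 1 10 8,
    .move 2 10 9, .reuse 177 12, .reuse 177 16, .reuse 131 12, .move 4 4 5, .move 4 2 10,
    .move 1 5 1, .assume 34 6, .move 0 10 3, .move 1 2 3, .move 2 6 5, .move 3 10 9, .move 2 10 8,
    .move 2 10 9, .move 3 4 9, .move 4 1 9, .move 5 12 9, .move 1 10 8, .move 4 4 6, .move 2 4 12,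
    .move 2 5 3, .move 12 12 4, .move 13 3 9, .move 1 3 9, .reuse 2 8, .reuse 2 9, .move 3 2 3,
    .move 0 9 8, .move 0 1 9, .move 5 4 5, .move 1 6 2, .move 0 4 6, .reuse 0 14, .move 1 3 1,
    .move 4 4 12, .move 0 12 8, .move 1 6 2, .move 1 5 12, .move 0 6 5, .move 0 8 10, .move 3 2 10,
    .qed, .move 0 12 8, .move 1 10 2, .move 2 12 9, .move 1 4 5, .move 1 9 8, .move 1 6 8,
    .reuse 131 16, .move 3 6 12, .move 3 10 8, .move 4 1 5, .move 2 12 8, .reuse 176 5, .move 3 1 5,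
    .move 3 6 4, .move 3 1 9, .move 2 4 12, .move 2 4 12, .move 2 5 3, .reuse 175 5, .move 4 9 8,
    .reuse 175 13, .move 6 12 8, .reuse 180 3, .move 6 12 8, .move 7 10 8, .move 7 9 8,
    .move 6 2 10, .move 5 2 10, .move 4 4 12, .move 4 4 6, .reuse 150 3, .move 6 4 5, .reuse 207 5,
    .move 7 2 3, .move 5 12 9, .move 6 10 9, .reuse 3 3, .move 8 2 3, .move 3 10 12, .reuse 162 5,
    .move 10 6 3, .move 9 5 3, .move 8 3 5, .reuse 7 16, .move 5 5 3, .move 7 10 2, .move 0 5 9,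
    .qed]),
  ([1, 2, 5, 10, 10, 12], [.reuse 2 16, .reuse 0 16, .reuse 0 23, .move 0 3 10]),
  ([1, 2, 2, 5, 10, 12], [.reuse 164 16, .reuse 1 16, .reuse 1 23, .move 0 3 2]),
  ([1, 1, 2, 4, 10, 12], [
    .reuse 180 21, .assume 0 16, .move 0 12 9, .move 1 10 9, .reuse 0 16, .move 3 4 5, .reuse 0 8,
    .move 5 2 3, .reuse 0 20, .move 6 2 6, .move 0 6 12, .move 0 1 3, .reuse 0 22, .move 9 4 6,
    .reuse 3 6, .move 7 1 9, .move 10 1 9, .move 1 9 8, .reuse 5 10, .reuse 5 11, .move 2 4 5,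
    .move 7 6 10, .reuse 3 13, .move 2 3 2, .move 0 8 9, .move 3 1 5, .qed]),
  ([1, 2, 5, 5, 10, 12], [
    .reuse 2 16, .assume 0 5, .reuse 1 16, .move 1 5 1, .reuse 116 16, .move 3 12 10, .reuse 67 11,
    .move 5 2 10, .move 6 5 9, .reuse 4 13, .reuse 3 16, .reuse 3 23, .move 10 5 3, .reuse 129 15,
    .move 12 12 8, .move 7 10 8, .move 0 10 8, .reuse 6 10, .reuse 6 15, .move 3 5 3, .move 16 1 9,
    .move 8 12 8, .reuse 3 5, .reuse 3 12, .move 7 5 3, .move 8 5 6, .move 6 3 2, .reuse 184 16,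
    .move 6 3 2, .move 0 2 6, .move 1 8 9, .reuse 223 13, .reuse 1 15, .move 8 5 6, .reuse 211 10,
    .move 10 5 3, .move 2 6 2, .move 3 3 2, .move 32 10 2, .move 0 5 9, .move 13 8 9, .reuse 180 12,
    .move 2 10 8, .move 0 2 10, .move 8 3 2, .move 0 8 10, .move 1 3 6, .move 6 12 8, .reuse 154 6,
    .move 23 5 6, .move 2 9 5, .move 1 6 2, .move 6 1 5, .move 1 8 10, .move 1 3 1, .move 4 5 6,
    .move 1 12 6, .move 2 5 6, .move 0 12 5, .qed]),
  ([1, 2, 5, 5, 10, 12], [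
    .reuse 0 23, .assume 0 13, .reuse 117 16, .move 1 12 10, .reuse 68 11, .move 3 2 10,
    .move 4 5 9, .reuse 5 13, .reuse 4 16, .reuse 4 23, .move 8 5 3, .move 9 12 8, .move 6 10 8,
    .reuse 7 10, .reuse 7 15, .move 4 12 8, .reuse 4 5, .reuse 4 12, .move 14 10 2, .move 0 5 9,
    .reuse 185 16, .move 5 3 2, .move 9 10 8, .move 10 5 3, .move 0 3 2, .move 0 8 9, .move 4 2 6,
    .move 5 8 9, .move 2 12 8, .reuse 181 12, .move 2 10 8, .move 8 5 3, .move 9 5 6, .reuse 2 15,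
    .move 1 5 3, .reuse 155 6, .move 3 5 6, .move 6 2 10, .reuse 224 13, .reuse 212 10, .move 8 5 3,
    .move 3 9 5, .move 7 6 2, .move 8 3 2, .move 3 3 2, .move 0 8 10, .move 1 3 6, .move 10 6 2,
    .move 6 5 6, .move 1 8 10, .move 4 1 5, .move 0 3 1, .move 0 12 6, .move 1 5 6, .move 0 12 5,
    .qed]),
  ([1, 2, 5, 6, 9, 12], [
    .reuse 20 23, .assume 0 17, .reuse 8 16, .reuse 8 17, .reuse 8 23, .move 3 12 10, .move 4 9 1,
    .reuse 6 15, .move 6 12 8, .reuse 3 22, .move 8 5 1, .reuse 181 23, .move 5 6 2, .reuse 156 21,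
    .move 7 6 12, .reuse 3 16, .move 9 6 10, .move 6 6 5, .reuse 13 18, .move 8 12 5, .move 0 6 12,
    .move 0 9 8, .reuse 192 23, .move 10 12 4, .move 7 10 8, .reuse 182 18, .move 2 1 9,
    .move 12 12 8, .move 0 12 10, .move 1 1 10, .move 3 4 6, .reuse 213 23, .move 3 8 10,
    .reuse 6 12, .move 1 10 2, .reuse 5 4, .reuse 5 13, .move 2 1 9, .move 3 10 6, .move 0 1 9,
    .move 0 2 10, .reuse 186 22, .move 2 5 4, .reuse 3 17, .reuse 213 22, .move 5 5 9, .move 3 4 12,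
    .move 1 9 12, .move 2 9 8, .move 1 12 8, .move 2 2 10, .move 10 10 8, .move 11 9 8,
    .move 12 6 2, .move 4 2 10, .reuse 5 11, .reuse 5 14, .move 5 2 10, .move 0 6 2, .reuse 186 16,
    .move 6 9 8, .move 6 1 5, .move 1 5 9, .reuse 186 14, .move 5 9 8, .move 2 2 6, .move 1 8 12,
    .move 5 9 1, .move 2 8 12, .move 1 6 12, .move 0 5 6, .move 0 8 9, .qed]),
  ([1, 1, 2, 5, 10, 12], [
    .reuse 4 16, .assume 0 10, .move 0 10 9, .reuse 14 12, .move 2 12 9, .reuse 214 23,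
    .move 4 12 10, .move 5 1 8, .reuse 185 15, .move 7 10 8, .reuse 183 17, .move 9 5 8,
    .move 7 10 12, .reuse 4 22, .move 1 5 6, .move 8 10 2, .reuse 187 14, .move 9 12 8, .reuse 0 10,
    .move 9 1 9, .reuse 3 15, .move 11 5 6, .move 12 2 8, .move 7 10 2, .reuse 7 8, .move 5 5 6,
    .reuse 0 13, .move 7 1 3, .reuse 4 11, .move 11 2 6, .move 8 1 9, .move 9 8 9, .reuse 64 11,
    .move 11 2 10, .move 10 1 9, .move 23 2 6, .reuse 4 12, .move 9 9 8, .move 15 1 3,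
    .move 16 12 10, .reuse 182 14, .move 5 12 8, .move 6 1 9, .reuse 187 17, .move 12 12 8,
    .reuse 242 16, .move 11 1 9, .reuse 226 6, .move 18 6 4, .move 7 1 9, .reuse 108 10,
    .move 12 1 3, .move 9 6 4, .reuse 214 14, .move 14 1 5, .move 10 1 5, .move 9 9 8, .reuse 4 7,
    .move 6 3 2, .reuse 4 13, .move 3 2 6, .move 6 5 4, .move 7 5 6, .reuse 14 9, .move 2 4 12,
    .move 3 1 3, .move 1 5 4, .move 2 5 6, .reuse 187 3, .move 3 3 2, .reuse 0 2, .move 8 8 12,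
    .move 4 8 9, .reuse 0 12, .move 18 1 3, .move 8 8 9, .reuse 187 5, .move 18 5 4, .move 6 12 4,
    .move 4 3 2, .move 2 3 6, .move 8 12 8, .reuse 187 7, .move 4 6 4, .reuse 9 2, .reuse 9 6,
    .move 7 1 9, .move 17 5 6, .reuse 183 8, .move 13 12 4, .reuse 187 4, .move 11 5 4,
    .move 11 8 9, .reuse 4 3, .move 10 1 3, .move 11 1 9, .move 9 5 4, .move 9 8 9, .move 8 1 5,
    .move 7 2 3, .move 8 2 10, .reuse 187 13, .move 20 10 2, .move 4 5 6, .reuse 214 7,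
    .move 6 9 10, .reuse 132 3, .move 6 10 9, .reuse 187 2, .move 5 10 2, .move 4 10 3,
    .move 1 4 12, .move 9 8 12, .move 1 12 9, .move 0 9 3, .move 4 4 6, .move 3 1 3, .move 0 12 4,
    .move 0 9 5, .move 0 2 10, .qed]),
  ([1, 2, 3, 4, 9, 12], [
    .reuse 8 23, .assume 0 5, .reuse 1 0, .move 1 12 6, .reuse 7 1, .reuse 7 18, .move 4 1 6,
    .reuse 2 18, .move 6 1 3, .reuse 8 3, .move 8 1 8, .move 2 3 10, .reuse 39 18, .move 9 1 9,
    .move 7 12 8, .move 3 10 8, .move 4 12 8, .reuse 10 5, .move 2 4 6, .move 5 9 8, .move 1 12 4,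
    .reuse 1 3, .move 5 2 6, .move 2 2 10, .qed]),
  ([1, 1, 2, 5, 6, 10], [
    .reuse 176 22, .assume 0 18, .reuse 189 23, .move 1 6 4, .reuse 11 16, .reuse 11 17,
    .move 4 1 9, .reuse 1 23, .reuse 216 23, .move 7 6 10, .move 8 5 1, .move 1 10 12, .reuse 0 15,
    .move 6 10 8, .reuse 2 17, .reuse 246 23, .move 5 10 6, .move 13 4 12, .move 14 1 3,
    .move 2 6 12, .reuse 1 17, .move 1 1 9, .reuse 8 16, .reuse 8 23, .move 5 4 12, .move 7 10 9,
    .reuse 16 12, .move 9 12 9, .move 10 1 9, .move 1 10 12, .move 5 10 8, .reuse 46 16,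
    .move 3 12 8, .reuse 0 13, .move 5 9 8, .move 6 10 8, .reuse 8 11, .reuse 8 14, .move 5 2 6,
    .reuse 189 14, .move 7 9 8, .move 0 5 9, .move 0 2 6, .move 13 5 6, .move 8 5 6, .reuse 2 13,
    .move 10 1 3, .reuse 5 15, .move 4 9 8, .move 10 10 2, .move 0 5 12, .move 2 1 9, .reuse 189 13,
    .move 1 12 8, .reuse 11 10, .reuse 11 15, .move 21 2 3, .move 3 2 10, .move 4 6 10,
    .move 2 10 2, .move 1 10 8, .reuse 15 16, .move 1 1 3, .reuse 247 13, .move 1 9 1, .move 7 9 8,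
    .reuse 15 17, .move 1 6 3, .move 21 9 1, .move 1 10 2, .move 0 8 12, .reuse 134 13,
    .move 3 5 12, .move 2 8 12, .qed]),
  ([1, 1, 2, 5, 6, 12], [
    .reuse 43 20, .assume 0 17, .move 0 12 4, .reuse 185 23, .move 2 6 2, .reuse 196 23,
    .move 1 12 4, .reuse 186 18, .move 1 1 9, .reuse 0 22, .move 1 4 6, .move 0 5 1, .move 1 9 1,
    .reuse 0 23, .move 1 2 10, .reuse 190 23, .move 1 6 4, .reuse 186 21, .move 3 5 4, .move 0 10 3,
    .move 3 10 6, .reuse 229 21, .move 1 5 9, .reuse 186 23, .move 3 5 12, .reuse 0 21, .move 1 2 3,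
    .reuse 217 17, .move 16 2 6, .reuse 190 21, .move 3 6 2, .move 2 6 4, .move 0 9 3, .move 0 6 12,
    .qed]),
  ([1, 2, 3, 5, 12, 12], [
    .reuse 42 23, .assume 0 12, .move 0 12 4, .move 0 12 4, .reuse 187 22, .move 2 3 2,
    .reuse 191 19, .move 3 3 10, .reuse 1 19, .move 1 1 3, .reuse 1 18, .move 5 1 3, .move 0 12 4,
    .move 0 2 10, .qed]),
  ([1, 2, 3, 4, 5, 12], [.reuse 49 18, .reuse 0 23, .move 0 12 4]),
  ([1, 2, 3, 4, 4, 5], [.reuse 49 21, .reuse 0 23, .move 0 12 4]),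
  ([1, 2, 3, 5, 12, 12], [
    .reuse 2 23, .assume 0 17, .move 0 3 1, .reuse 160 17, .move 2 5 1, .reuse 3 23, .move 3 12 6,
    .move 2 2 6, .reuse 0 19, .move 2 12 4, .reuse 145 17, .move 4 5 12, .reuse 233 21, .move 3 5 9,
    .reuse 252 21, .move 5 5 1, .move 4 2 3, .move 0 3 1, .move 0 12 4, .reuse 251 21, .move 1 12 6,
    .move 0 6 2, .move 0 1 9, .reuse 0 18, .move 2 1 3, .reuse 1 18, .move 3 1 3, .reuse 194 22,
    .move 1 3 2, .move 4 6 2, .reuse 4 22, .move 2 4 5, .reuse 0 21, .move 3 1 5, .reuse 190 18,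
    .move 1 3 9, .move 0 4 6, .qed]),
  ([1, 2, 3, 4, 12, 12], [.reuse 140 19, .reuse 0 23, .move 0 5 4]),
  ([2, 3, 3, 4, 12, 12], [.reuse 128 1, .reuse 0 22, .reuse 0 23, .move 0 1 3]),
  ([2, 3, 3, 4, 12, 12], [.reuse 0 3, .reuse 0 23])]

theorem refutesRule_certificate : refutesRule certificate [] = true := by decide +kernel

end PartyApproval

/-- There is no party-approval rule for 6 voters, 4 parties, and
committee size 3 that satisfies anonymity, weak representation, Pareto optimality,
and strategyproofness. -/
theorem no_anonymous_weakRep_pareto_strategyproof_rule_6_4_3 :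
    ¬ ∃ f : (Fin 6 → Finset (Fin 4)) → Multiset (Fin 4),
        IsPAPPRule 6 3 f ∧ Anonymous 6 f ∧ WeakRep 6 3 f ∧ ParetoOptimal 6 f ∧
          Strategyproof 6 f := by
  rintro ⟨f, hf⟩
  exact PartyApproval.not_desirable_of_refutesRule PartyApproval.certificate []
    (fun _ he => (List.not_mem_nil he).elim) PartyApproval.refutesRule_certificate f hf
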